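/- The quotient P(V_{1,8})/(SL₂(ℂ)×SL₂(ℂ)) is rational: the field of SL₂×SL₂-invariant rational functions on the 17-dimensional projective space P(V_{1,8}) of bidegree (1,8) biforms is a purely transcendental extension of ℂ of transcendence degree 11. -/

import Mathlib

set_option synthInstance.maxHeartbeats 1000000
set_option maxHeartbeats 1000000
noncomputable section
open MvPolynomial

/-- The field of invariant rational functions: the subfield of the fraction field of `R`
consisting of elements fixed by a family of `ℂ`-algebra endomorphisms of `R`. -/
def invariantField (R : Type*) [CommRing R] [IsDomain R] [Algebra ℂ R]
    {ι : Type*} (φ : ι → (R →ₐ[ℂ] R)) : IntermediateField ℂ (FractionRing R) where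
  carrier := {x | ∃ f g : R, g ≠ 0 ∧
      x = algebraMap R (FractionRing R) f / algebraMap R (FractionRing R) g ∧
      ∀ i, φ i f * g = φ i g * f}
  mul_mem' := by
    rintro x y ⟨f, g, hg, rfl, hf⟩ ⟨p, q, hq, rfl, hp⟩
    exact ⟨f * p, g * q, mul_ne_zero hg hq,
      by rw [map_mul, map_mul, div_mul_div_comm],
      fun i => by
        simp only [map_mul]
        linear_combination (φ i p * q) * hf i + (φ i g * f) * hp i⟩
  one_mem' := ⟨1, 1, one_ne_zero, by simp, fun i => rfl⟩
  add_mem' := by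
    rintro x y ⟨f, g, hg, rfl, hf⟩ ⟨p, q, hq, rfl, hp⟩
    have hg' : algebraMap R (FractionRing R) g ≠ 0 :=
      fun h => hg ((map_eq_zero_iff _ (IsFractionRing.injective R (FractionRing R))).mp h)
    have hq' : algebraMap R (FractionRing R) q ≠ 0 :=
      fun h => hq ((map_eq_zero_iff _ (IsFractionRing.injective R (FractionRing R))).mp h)
    refine ⟨f * q + g * p, g * q, mul_ne_zero hg hq, ?_, fun i => ?_⟩
    · rw [map_add, map_mul, map_mul, map_mul, div_add_div _ _ hg' hq']
    · simp only [map_add, map_mul]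
      linear_combination (φ i q * q) * hf i + (φ i g * g) * hp i
  zero_mem' := ⟨0, 1, one_ne_zero, by simp, fun i => by simp⟩
  algebraMap_mem' := fun c =>
    ⟨algebraMap ℂ R c, 1, one_ne_zero,
      by rw [map_one, div_one, ← IsScalarTower.algebraMap_apply],
      fun i => by simp [AlgHom.commutes]⟩
  inv_mem' := by
    rintro x ⟨f, g, hg, rfl, hf⟩
    by_cases hf0 : f = 0
    · exact ⟨0, 1, one_ne_zero, by simp [hf0], fun i => by simp⟩
    · exact ⟨g, f, hf0, by rw [inv_div], fun i => (hf i).symm⟩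

abbrev SL2 := Matrix.SpecialLinearGroup (Fin 2) ℂ

/-- The action of `SL₂(ℂ)` on binary forms by linear substitution of the variables. -/
def sub1 (g : SL2) : MvPolynomial (Fin 2) ℂ →ₐ[ℂ] MvPolynomial (Fin 2) ℂ :=
  aeval fun i => ∑ j, C (g.1 i j) * X j

/-- The matrix of the action of `g` on `V_d` in the basis of monomials `X^i Y^(d-i)`. -/
def repMat (d : ℕ) (g : SL2) (i j : Fin (d + 1)) : ℂ :=
  coeff (Finsupp.single 0 (i : ℕ) + Finsupp.single 1 (d - (i : ℕ)))
    (sub1 g (X 0 ^ (j : ℕ) * X 1 ^ (d - (j : ℕ))))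

/-- The endomorphism of the coordinate ring of `V_{a,b} = V_a ⊗ V_b` induced by
`(g, h) ∈ SL₂ × SL₂` together with the scaling by `t` (so that invariance under the
scalings expresses that a rational function descends to the projectivization). -/
def coordHomAB (a b : ℕ) (g h : SL2) (t : ℂˣ) :
    MvPolynomial (Fin (a + 1) × Fin (b + 1)) ℂ →ₐ[ℂ]
      MvPolynomial (Fin (a + 1) × Fin (b + 1)) ℂ :=
  aeval fun p => (t : ℂ) • ∑ q, C (repMat a g p.1 q.1 * repMat b h p.2 q.2) * X q

/-- The field `ℂ(P(V_{a,b}))^{SL₂×SL₂}` of `SL₂(ℂ) × SL₂(ℂ)`-invariant rational functions on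
the projective space of biforms of bidegree `(a,b)`, realized as the field of rational
functions in the coefficient coordinates (indexed by `Fin (a+1) × Fin (b+1)`) that are
invariant under the induced linear action and under scaling. -/
def invFieldAB (a b : ℕ) :
    IntermediateField ℂ (FractionRing (MvPolynomial (Fin (a + 1) × Fin (b + 1)) ℂ)) :=
  invariantField _ fun γ : SL2 × SL2 × ℂˣ => coordHomAB a b γ.1 γ.2.1 γ.2.2


section helpers
set_option linter.all false

/-- points of the double cover `r ^ 2 = δ` -/
def TT {σ : Type} (δ : MvPolynomial σ ℂ) : Type := {x : (σ → ℂ) × ℂ // x.2 ^ 2 = eval x.1 δ}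

/-- regular functions on the double cover -/
def BB {σ : Type} (δ : MvPolynomial σ ℂ) : Subalgebra ℂ (TT δ → ℂ) where
  carrier := {F | ∃ p q : MvPolynomial σ ℂ, ∀ x : TT δ, F x = eval x.1.1 p + x.1.2 * eval x.1.1 q}
  mul_mem' := by
    rintro F G ⟨p, q, h⟩ ⟨p', q', h'⟩
    refine ⟨p * p' + δ * (q * q'), p * q' + p' * q, fun x => ?_⟩
    have := x.2
    simp only [Pi.mul_apply, h, h', map_add, map_mul]
    linear_combination (eval x.1.1 q * eval x.1.1 q') * this
  add_mem' := by
    rintro F G ⟨p, q, h⟩ ⟨p', q', h'⟩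
    refine ⟨p + p', q + q', fun x => ?_⟩
    simp only [Pi.add_apply, h, h', map_add]
    ring
  algebraMap_mem' := fun c => ⟨C c, 0, fun x => by simp⟩

lemma BB_fst {σ : Type} (δ : MvPolynomial σ ℂ) (p : MvPolynomial σ ℂ) :
    (fun x : TT δ => eval x.1.1 p) ∈ BB δ := ⟨p, 0, fun x => by simp⟩

lemma BB_snd {σ : Type} (δ : MvPolynomial σ ℂ) :
    (fun x : TT δ => x.1.2) ∈ BB δ := ⟨0, 1, fun x => by simp⟩

lemma BB_comp {σ τ : Type} (δ : MvPolynomial σ ℂ) (S : TT δ → τ → ℂ)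
    (hS : ∀ s, (fun x => S x s) ∈ BB δ) (f : MvPolynomial τ ℂ) :
    (fun x => eval (S x) f) ∈ BB δ := by
  induction f using MvPolynomial.induction_on with
  | C a => exact ⟨C a, 0, fun x => by simp⟩
  | add p q hp hq =>
    simp only [map_add]
    exact (BB δ).add_mem hp hq
  | mul_X p i hp =>
    simp only [map_mul, eval_X]
    exact (BB δ).mul_mem hp (hS i)

/-- if `q0 ^ 2 = X c * q1 ^ 2` then both vanish. -/
lemma parity {n : ℕ} (c : Fin n) (q0 q1 : MvPolynomial (Fin n) ℂ)
    (h : q0 ^ 2 - X c * q1 ^ 2 = 0) : q0 = 0 ∧ q1 = 0 := by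
  have h' : q0 * q0 = X c * (q1 * q1) := by linear_combination h
  by_cases h1 : q1 = 0
  · subst h1
    simp at h'
    exact ⟨h', rfl⟩
  · exfalso
    have h0 : q0 ≠ 0 := by
      rintro rfl
      simp [h1] at h'
    have := congrArg totalDegree h'
    rw [totalDegree_mul_of_isDomain h0 h0, totalDegree_mul_of_isDomain (X_ne_zero c)
      (mul_ne_zero h1 h1), totalDegree_mul_of_isDomain h1 h1, totalDegree_X] at this
    omega

lemma eq_zero_of_generic {σ : Type} [Finite σ] (f D : MvPolynomial σ ℂ) (hD : D ≠ 0)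
    (h : ∀ v, eval v D ≠ 0 → eval v f = 0) : f = 0 := by
  have : f * D = 0 := by
    apply MvPolynomial.funext
    intro v
    by_cases hv : eval v D = 0
    · simp [hv]
    · simp [h v hv]
  exact (mul_eq_zero.mp this).resolve_right hD

lemma hom_lemma {σ : Type} {n : ℕ} (N : Fin n → MvPolynomial σ ℂ) (D : MvPolynomial σ ℂ)
    (hD : D ≠ 0) (P : MvPolynomial (Fin n) ℂ) :
    ∃ (H : MvPolynomial σ ℂ) (m : ℕ),
      algebraMap _ (FractionRing (MvPolynomial σ ℂ)) H = (algebraMap _ _ D) ^ m *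
        aeval (fun i => algebraMap _ (FractionRing (MvPolynomial σ ℂ)) (N i) /
          algebraMap _ (FractionRing (MvPolynomial σ ℂ)) D) P ∧
      ∀ v, eval v D ≠ 0 → eval v H = eval v D ^ m * eval (fun i => eval v (N i) / eval v D) P := by
  have hD' : algebraMap _ (FractionRing (MvPolynomial σ ℂ)) D ≠ 0 := by
    simpa using hD
  induction P using MvPolynomial.induction_on with
  | C a => exact ⟨C a, 0, by
      rw [pow_zero, one_mul, aeval_C, ← MvPolynomial.algebraMap_eq,
        ← IsScalarTower.algebraMap_apply], by simp⟩
  | add p q hp hq =>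
    obtain ⟨H, m, h1, h2⟩ := hp
    obtain ⟨H', m', h1', h2'⟩ := hq
    refine ⟨H * D ^ m' + H' * D ^ m, m + m', ?_, fun v hv => ?_⟩
    · simp only [map_add, map_mul, map_pow, h1, h1']; ring
    · simp only [map_add, map_mul, map_pow, h2 v hv, h2' v hv]; ring
  | mul_X p i hp =>
    obtain ⟨H, m, h1, h2⟩ := hp
    refine ⟨H * N i, m + 1, ?_, fun v hv => ?_⟩
    · simp only [map_mul, h1, aeval_X]; field_simp; ring
    · simp only [map_mul, h2 v hv, eval_X]; field_simp; ring

theorem abstract_iso {σ : Type} [Finite σ] {n : ℕ} {ι : Type}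
    (φ : ι → (MvPolynomial σ ℂ →ₐ[ℂ] MvPolynomial σ ℂ))
    (act : ι → (σ → ℂ) → (σ → ℂ))
    (hact : ∀ i v f, eval v (φ i f) = eval (act i v) f)
    (symm : ∀ i v, ∃ j, act j (act i v) = v)
    (surj_act : ∀ i v, ∃ w, act i w = v)
    (tran : ∀ i j v, ∃ k, act j (act i v) = act k v)
    (N : Fin n → MvPolynomial σ ℂ) (D : MvPolynomial σ ℂ) (hD : D ≠ 0)
    (hinv : ∀ i v, eval v D ≠ 0 → eval (act i v) D ≠ 0 → ∀ j,
      eval (act i v) (N j) * eval v D = eval v (N j) * eval (act i v) D)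
    (c : Fin n) (S : (Fin n → ℂ) → ℂ → σ → ℂ)
    (hS : ∀ s, (fun x : TT (X c : MvPolynomial (Fin n) ℂ) => S x.1.1 x.1.2 s) ∈ BB (X c))
    (E : MvPolynomial (Fin n) ℂ) (hE : E ≠ 0)
    (hswap : ∀ y r, r ^ 2 = y c → eval y E ≠ 0 → ∃ i, act i (S y r) = S y (-r))
    (hsur : ∀ y, eval y E ≠ 0 → ∃ v, eval v D ≠ 0 ∧ ∀ j, eval v (N j) = y j * eval v D)
    (horb : ∀ v, eval v D ≠ 0 → ∃ r, r ^ 2 = eval v (N c) / eval v D ∧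
      ∃ i, act i (S (fun j => eval v (N j) / eval v D) r) = v) :
    Nonempty ((invariantField (MvPolynomial σ ℂ) φ) ≃ₐ[ℂ]
      FractionRing (MvPolynomial (Fin n) ℂ)) := by
  have hD' : algebraMap _ (FractionRing (MvPolynomial σ ℂ)) D ≠ 0 := by simpa using hD
  set I : Fin n → FractionRing (MvPolynomial σ ℂ) := fun i =>
    algebraMap _ (FractionRing (MvPolynomial σ ℂ)) (N i) /
          algebraMap _ (FractionRing (MvPolynomial σ ℂ)) D with hI
  have hinj : Function.Injective (aeval (R := ℂ) I) := by
    rw [injective_iff_map_eq_zero]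
    intro P hP
    obtain ⟨H, m, h1, h2⟩ := hom_lemma N D hD P
    rw [← hI, hP, mul_zero] at h1
    have h1 : H = 0 := by simpa using h1
    refine eq_zero_of_generic P E hE fun y hy => ?_
    obtain ⟨v, hv, hv'⟩ := hsur y hy
    have := h2 v hv
    rw [h1, map_zero] at this
    have hy : (fun i => eval v (N i) / eval v D) = y := by
      funext j
      rw [hv' j]; field_simp
    rw [hy] at this
    simpa [hv] using this.symm
  let Φ : FractionRing (MvPolynomial (Fin n) ℂ) →ₐ[ℂ] FractionRing (MvPolynomial σ ℂ) :=
    IsFractionRing.liftAlgHom hinj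
  have hΦ : ∀ P, Φ (algebraMap _ _ P) = aeval I P := fun P =>
    IsFractionRing.lift_algebraMap hinj P
  have hmemI : ∀ j, I j ∈ invariantField (MvPolynomial σ ℂ) φ := by
    intro j
    refine ⟨N j, D, hD, rfl, fun i => ?_⟩
    have hDi : φ i D ≠ 0 := by
      intro h0
      apply hD
      apply MvPolynomial.funext
      intro v
      obtain ⟨w, rfl⟩ := surj_act i v
      rw [← hact, h0]; simp
    rw [← sub_eq_zero]
    refine eq_zero_of_generic _ (D * φ i D) (mul_ne_zero hD hDi) fun v hv => ?_
    rw [map_mul, hact] at hv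
    have := hinv i v (left_ne_zero_of_mul hv) (right_ne_zero_of_mul hv) j
    simp only [map_sub, map_mul, hact]
    linear_combination this
  have hmem : ∀ x, Φ x ∈ (invariantField (MvPolynomial σ ℂ) φ).toSubalgebra := by
    intro x
    obtain ⟨p, q, hq, rfl⟩ := IsFractionRing.div_surjective (A := MvPolynomial (Fin n) ℂ) x
    have key : ∀ P : MvPolynomial (Fin n) ℂ, aeval I P ∈ invariantField (MvPolynomial σ ℂ) φ := by
      intro P
      induction P using MvPolynomial.induction_on with
      | C a =>
        rw [aeval_C]
        exact (invariantField (MvPolynomial σ ℂ) φ).algebraMap_mem a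
      | add p q hp hq => rw [map_add]; exact add_mem hp hq
      | mul_X p i hp => rw [map_mul, aeval_X]; exact mul_mem hp (hmemI i)
    rw [map_div₀, hΦ, hΦ]
    exact (invariantField (MvPolynomial σ ℂ) φ).div_mem (key p) (key q)
  refine ⟨(AlgEquiv.ofBijective (Φ.codRestrict (invariantField (MvPolynomial σ ℂ) φ).toSubalgebra hmem)
    ⟨?_, ?_⟩).symm⟩
  · intro x y hxy
    exact Φ.injective (congrArg Subtype.val hxy)
  · rintro ⟨x, f, g, hg, rfl, hfg⟩
    have hfg' : ∀ i v, eval (act i v) f * eval v g = eval (act i v) g * eval v f := by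
      intro i v
      have := congrArg (eval v) (hfg i)
      simpa only [map_mul, hact] using this
    -- a good point
    obtain ⟨v0, hv0⟩ : ∃ v0, eval v0 (g * D) ≠ 0 := by
      by_contra! hcon
      exact mul_ne_zero hg hD (MvPolynomial.funext (by simpa using hcon))
    rw [map_mul] at hv0
    obtain ⟨r0, hr0, i0, hi0⟩ := horb v0 (right_ne_zero_of_mul hv0)
    set y0 : Fin n → ℂ := fun j => eval v0 (N j) / eval v0 D with hy0
    have hcomp : ∀ F : MvPolynomial σ ℂ, (fun x : TT (X c : MvPolynomial (Fin n) ℂ) =>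
        eval (act i0 (S x.1.1 x.1.2)) F) ∈ BB (X c) := by
      intro F
      have := BB_comp (X c) (fun x => S x.1.1 x.1.2) hS (φ i0 F)
      simpa only [hact] using this
    obtain ⟨p0, p1, hp⟩ := hcomp f
    obtain ⟨q0, q1, hq⟩ := hcomp g
    have hp : ∀ y r, r ^ 2 = y c → eval (act i0 (S y r)) f = eval y p0 + r * eval y p1 :=
      fun y r h => hp ⟨(y, r), by simpa using h⟩
    have hq : ∀ y r, r ^ 2 = y c → eval (act i0 (S y r)) g = eval y q0 + r * eval y q1 :=
      fun y r h => hq ⟨(y, r), by simpa using h⟩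
    have hQ0 : eval y0 q0 + r0 * eval y0 q1 ≠ 0 := by
      rw [← hq y0 r0 hr0, hi0]
      exact left_ne_zero_of_mul hv0
    have hnorm : q0 ^ 2 - X c * q1 ^ 2 ≠ 0 := by
      intro h
      obtain ⟨rfl, rfl⟩ := parity c q0 q1 h
      simp at hQ0
    have hpq : p1 * q0 = p0 * q1 := by
      rw [← sub_eq_zero]
      refine eq_zero_of_generic _ (E * X c) (mul_ne_zero hE (X_ne_zero c)) fun y hy => ?_
      rw [map_mul, eval_X] at hy
      obtain ⟨r, hr'⟩ := IsAlgClosed.exists_pow_nat_eq (y c) (n := 2) (by norm_num)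
      have hr : y c = r ^ 2 := hr'.symm
      have hr0 : r ≠ 0 := by
        rintro rfl
        apply right_ne_zero_of_mul hy
        rw [hr]; simp
      obtain ⟨i, hi⟩ := hswap y r hr.symm (left_ne_zero_of_mul hy)
      obtain ⟨j, hj⟩ := symm i0 (S y r)
      obtain ⟨k, hk⟩ := tran j i (act i0 (S y r))
      obtain ⟨l, hl⟩ := tran k i0 (act i0 (S y r))
      have := hfg' l (act i0 (S y r))
      rw [← hl, ← hk, hj, hi, hp y r hr.symm, hq y r hr.symm, hp y (-r) (by rw [hr]; ring),
        hq y (-r) (by rw [hr]; ring)] at this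
      simp only [map_sub, map_mul]
      apply mul_left_cancel₀ (mul_ne_zero two_ne_zero hr0)
      linear_combination -this
    have hgen : ∀ (a b : MvPolynomial (Fin n) ℂ), b ≠ 0 → (∀ y r, r ^ 2 = y c →
        eval y a * (eval y q0 + r * eval y q1) = eval y b * (eval y p0 + r * eval y p1)) →
        algebraMap _ (FractionRing (MvPolynomial σ ℂ)) f / algebraMap _ _ g =
          aeval I a / aeval I b := by
      intro a b hb hab
      have hg' : algebraMap _ (FractionRing (MvPolynomial σ ℂ)) g ≠ 0 := by simpa using hg
      have hb' : aeval I b ≠ 0 := by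
        rw [Ne, map_eq_zero_iff _ hinj]; exact hb
      rw [div_eq_div_iff hg' hb']
      obtain ⟨Ha, ma, ha1, ha2⟩ := hom_lemma N D hD a
      obtain ⟨Hb, mb, hb1, hb2⟩ := hom_lemma N D hD b
      obtain ⟨Hn, mn, hn1, hn2⟩ := hom_lemma N D hD (q0 ^ 2 - X c * q1 ^ 2)
      rw [← hI] at ha1 hb1 hn1
      have hHn : Hn ≠ 0 := by
        rintro rfl
        rw [map_zero] at hn1
        have := (mul_eq_zero.mp hn1.symm).resolve_left (pow_ne_zero _ hD')
        rw [map_eq_zero_iff _ hinj] at this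
        exact hnorm this
      have hpoly : f * Hb * D ^ ma = g * Ha * D ^ mb := by
        rw [← sub_eq_zero]
        refine eq_zero_of_generic _ (D * Hn) (mul_ne_zero hD hHn) fun v hv => ?_
        rw [map_mul] at hv
        have hvD := left_ne_zero_of_mul hv
        have hvn := right_ne_zero_of_mul hv
        rw [hn2 v hvD] at hvn
        have hvn := right_ne_zero_of_mul hvn
        obtain ⟨r, hr, i, hi⟩ := horb v hvD
        simp only [map_sub, map_mul, map_pow]
        rw [ha2 v hvD, hb2 v hvD]
        set y : Fin n → ℂ := fun j => eval v (N j) / eval v D with hy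
        have hr : r ^ 2 = y c := hr
        have hQ : eval y q0 + r * eval y q1 ≠ 0 := by
          intro h
          apply hvn
          simp only [map_sub, map_mul, map_pow, eval_X, ← hr]
          linear_combination (eval y q0 - r * eval y q1) * h
        obtain ⟨j, hj⟩ := symm i0 (S y r)
        obtain ⟨k, hk⟩ := tran j i (act i0 (S y r))
        have h1 := hfg' k (act i0 (S y r))
        rw [← hk, hj, hi, hp y r hr, hq y r hr] at h1
        have h2 := hab y r hr
        apply mul_left_cancel₀ hQ
        linear_combination (eval v D ^ ma * eval v D ^ mb) * (eval y b * h1 - eval v g * h2)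
      have := congrArg (algebraMap _ (FractionRing (MvPolynomial σ ℂ))) hpoly
      simp only [map_mul, map_pow, ha1, hb1] at this
      apply mul_left_cancel₀ (mul_ne_zero (pow_ne_zero ma hD') (pow_ne_zero mb hD'))
      linear_combination this
    have hev : ∀ y : Fin n → ℂ, eval y p1 * eval y q0 = eval y p0 * eval y q1 := fun y => by
      simpa only [map_mul] using congrArg (eval y) hpq
    obtain ⟨a, b, hab⟩ : ∃ a b, algebraMap _ (FractionRing (MvPolynomial σ ℂ)) f / algebraMap _ _ g =
          aeval I a / aeval I b := by
      by_cases h0 : q0 = 0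
      · have h1 : q1 ≠ 0 := by
          rintro rfl
          simp [h0] at hQ0
        exact ⟨p1, q1, hgen p1 q1 h1 fun y r hr => by linear_combination hev y⟩
      · exact ⟨p0, q0, hgen p0 q0 h0 fun y r hr => by linear_combination -r * hev y⟩
    refine ⟨algebraMap _ _ a / algebraMap _ _ b, ?_⟩
    apply Subtype.ext
    rw [AlgHom.coe_codRestrict, map_div₀, hΦ, hΦ]
    exact hab.symm


lemma eval_homog (d : ℕ) (p : MvPolynomial (Fin 2) ℂ) (hp : p.IsHomogeneous d) (x y : ℂ) :
    eval ![x, y] p = ∑ i : Fin (d + 1),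
      coeff (Finsupp.single 0 (i : ℕ) + Finsupp.single 1 (d - (i : ℕ))) p *
        (x ^ (i : ℕ) * y ^ (d - (i : ℕ))) := by
  classical
  let e : Fin (d + 1) → (Fin 2 →₀ ℕ) := fun i =>
    Finsupp.single 0 (i : ℕ) + Finsupp.single 1 (d - (i : ℕ))
  have hinj : Function.Injective e := by
    intro i j hij
    have := DFunLike.congr_fun hij 0
    simp [e] at this
    exact Fin.ext this
  rw [MvPolynomial.eval_eq']
  rw [Finset.sum_subset (s₂ := Finset.univ.image e)]
  · rw [Finset.sum_image (fun a _ b _ h => hinj h)]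
    refine Finset.sum_congr rfl fun i _ => ?_
    simp [e, Fin.prod_univ_two]
  · intro m hm
    have h1 := hp (mem_support_iff.mp hm)
    have h2 : m 0 + m 1 = d := by
      rw [← h1]
      simp [Finsupp.weight_apply, Finsupp.sum_fintype]
    rw [Finset.mem_image]
    refine ⟨⟨m 0, by omega⟩, Finset.mem_univ _, ?_⟩
    ext k
    fin_cases k
    · simp [e]
    · simp [e]; omega
  · intro m _ hm
    rw [notMem_support_iff.mp hm, zero_mul]

lemma repMat_eval (d : ℕ) (g : SL2) (j : Fin (d + 1)) (x y : ℂ) :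
    ∑ i, repMat d g i j * (x ^ (i : ℕ) * y ^ (d - (i : ℕ))) =
      (g.1 0 0 * x + g.1 0 1 * y) ^ (j : ℕ) * (g.1 1 0 * x + g.1 1 1 * y) ^ (d - (j : ℕ)) := by
  have hl : ∀ i, (∑ k, C (g.1 i k) * X k : MvPolynomial (Fin 2) ℂ).IsHomogeneous 1 := by
    intro i
    apply IsHomogeneous.sum
    intro k _
    have := (isHomogeneous_C (Fin 2) (g.1 i k)).mul (isHomogeneous_X ℂ k)
    simpa using this
  have hh : (sub1 g (X 0 ^ (j : ℕ) * X 1 ^ (d - (j : ℕ)))).IsHomogeneous d := by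
    have := ((hl 0).pow (j : ℕ)).mul ((hl 1).pow (d - (j : ℕ)))
    have hd : 1 * (j : ℕ) + 1 * (d - (j : ℕ)) = d := by omega
    rw [hd] at this
    simpa only [sub1, map_mul, map_pow, aeval_X] using this
  have := eval_homog d _ hh x y
  unfold repMat
  rw [← this]
  simp [sub1, Fin.sum_univ_two]

abbrev Pt := Fin (1 + 1) × Fin (8 + 1) → ℂ

def frm (f : Fin 9 → ℂ) (x y : ℂ) : ℂ := ∑ k : Fin 9, f k * (x ^ (k : ℕ) * y ^ (8 - (k : ℕ)))

lemma frm_inj (f f' : Fin 9 → ℂ) (h : ∀ x y, frm f x y = frm f' x y) : f = f' := by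
  have : (∑ k : Fin 9, Polynomial.monomial (k : ℕ) (f k) : Polynomial ℂ) =
      ∑ k : Fin 9, Polynomial.monomial (k : ℕ) (f' k) := by
    apply Polynomial.funext
    intro x
    have := h x 1
    simpa [frm, Polynomial.eval_finsetSum] using this
  funext k
  have := congrArg (fun p => Polynomial.coeff p (k : ℕ)) this
  simpa [Polynomial.finsetSum_coeff, Polynomial.coeff_monomial, Fin.val_inj] using this

/-- `GL₂ × GL₂`-equivalence of pencils -/
def RelBy (a b c d a' b' c' d' : ℂ) (v w : Pt) : Prop :=
  ∀ x y, frm (fun k => w (0, k)) x y =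
      a * frm (fun k => v (0, k)) (a' * x + b' * y) (c' * x + d' * y) +
      b * frm (fun k => v (1, k)) (a' * x + b' * y) (c' * x + d' * y) ∧
    frm (fun k => w (1, k)) x y =
      c * frm (fun k => v (0, k)) (a' * x + b' * y) (c' * x + d' * y) +
      d * frm (fun k => v (1, k)) (a' * x + b' * y) (c' * x + d' * y)

def PRel (v w : Pt) : Prop := ∃ a b c d a' b' c' d' : ℂ, a * d - b * c ≠ 0 ∧ a' * d' - b' * c' ≠ 0 ∧
  RelBy a b c d a' b' c' d' v w

lemma PRel.trans {u v w : Pt} (h : PRel u v) (h' : PRel v w) : PRel u w := by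
  obtain ⟨a, b, c, d, a', b', c', d', h1, h2, h3⟩ := h
  obtain ⟨e, f, g, i, e', f', g', i', k1, k2, k3⟩ := h'
  refine ⟨e * a + f * c, e * b + f * d, g * a + i * c, g * b + i * d,
    a' * e' + b' * g', a' * f' + b' * i', c' * e' + d' * g', c' * f' + d' * i', ?_, ?_, ?_⟩
  · convert mul_ne_zero h1 k1 using 1; ring
  · convert mul_ne_zero h2 k2 using 1; ring
  · intro x y
    have e1 : (a' * e' + b' * g') * x + (a' * f' + b' * i') * y =
      a' * (e' * x + f' * y) + b' * (g' * x + i' * y) := by ring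
    have e2 : (c' * e' + d' * g') * x + (c' * f' + d' * i') * y =
      c' * (e' * x + f' * y) + d' * (g' * x + i' * y) := by ring
    rw [e1, e2, (k3 x y).1, (k3 x y).2, (h3 _ _).1, (h3 _ _).2]
    constructor <;> ring

lemma PRel.symm {v w : Pt} (h : PRel v w) : PRel w v := by
  obtain ⟨a, b, c, d, a', b', c', d', h1, h2, h3⟩ := h
  obtain ⟨e, he⟩ : ∃ e, (a * d - b * c) * e = 1 := ⟨_, mul_inv_cancel₀ h1⟩
  obtain ⟨e', he'⟩ : ∃ e', (a' * d' - b' * c') * e' = 1 := ⟨_, mul_inv_cancel₀ h2⟩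
  refine ⟨d * e, -b * e, -c * e, a * e, d' * e', -b' * e', -c' * e', a' * e', ?_, ?_, ?_⟩
  · intro h0
    apply one_ne_zero (α := ℂ)
    linear_combination (a * d - b * c) * h0 - (1 + (a * d - b * c) * e) * he
  · intro h0
    apply one_ne_zero (α := ℂ)
    linear_combination (a' * d' - b' * c') * h0 - (1 + (a' * d' - b' * c') * e') * he'
  · intro x y
    have k := h3 (d' * e' * x + -b' * e' * y) (-c' * e' * x + a' * e' * y)
    have e1 : a' * (d' * e' * x + -b' * e' * y) + b' * (-c' * e' * x + a' * e' * y) = x := by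
      linear_combination x * he'
    have e2 : c' * (d' * e' * x + -b' * e' * y) + d' * (-c' * e' * x + a' * e' * y) = y := by
      linear_combination y * he'
    rw [e1, e2] at k
    rw [k.1, k.2]
    constructor
    · linear_combination -(frm (fun k => v (0, k)) x y) * he
    · linear_combination -(frm (fun k => v (1, k)) x y) * he

/-- the pointwise action -/
def actP (γ : SL2 × SL2 × ℂˣ) (v : Pt) : Pt := fun p =>
  (γ.2.2 : ℂ) * ∑ q, (repMat 1 γ.1 p.1 q.1 * repMat 8 γ.2.1 p.2 q.2) * v q

lemma hactP (γ : SL2 × SL2 × ℂˣ) (v : Pt) (f : MvPolynomial (Fin (1 + 1) × Fin (8 + 1)) ℂ) :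
    eval v (coordHomAB 1 8 γ.1 γ.2.1 γ.2.2 f) = eval (actP γ v) f := by
  induction f using MvPolynomial.induction_on with
  | C a => simp [coordHomAB]
  | add p q hp hq => rw [map_add, map_add, hp, hq, map_add]
  | mul_X p i hp =>
    rw [map_mul, map_mul, hp, map_mul]
    congr 1
    simp [coordHomAB, actP, smul_eval]

lemma repMat_one (g : SL2) : repMat 1 g 1 1 = g.1 0 0 ∧ repMat 1 g 0 1 = g.1 0 1 ∧
    repMat 1 g 1 0 = g.1 1 0 ∧ repMat 1 g 0 0 = g.1 1 1 := by
  have h0 : ∀ x y : ℂ, repMat 1 g 0 0 * (x ^ 0 * y ^ 1) + repMat 1 g 1 0 * (x ^ 1 * y ^ 0) =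
      (g.1 0 0 * x + g.1 0 1 * y) ^ 0 * (g.1 1 0 * x + g.1 1 1 * y) ^ 1 := by
    intro x y
    have := repMat_eval 1 g 0 x y
    rw [Fin.sum_univ_two] at this
    exact this
  have h1 : ∀ x y : ℂ, repMat 1 g 0 1 * (x ^ 0 * y ^ 1) + repMat 1 g 1 1 * (x ^ 1 * y ^ 0) =
      (g.1 0 0 * x + g.1 0 1 * y) ^ 1 * (g.1 1 0 * x + g.1 1 1 * y) ^ 0 := by
    intro x y
    have := repMat_eval 1 g 1 x y
    rw [Fin.sum_univ_two] at this
    exact this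
  have a := h0 1 0
  have b := h0 0 1
  have c := h1 1 0
  have d := h1 0 1
  simp at a b c d
  exact ⟨c, d, a, b⟩

lemma frm_act (γ : SL2 × SL2 × ℂˣ) (v : Pt) (i : Fin (1 + 1)) (x y : ℂ) :
    frm (fun k => actP γ v (i, k)) x y = (γ.2.2 : ℂ) *
      (repMat 1 γ.1 i 0 * frm (fun k => v (0, k)) (γ.2.1.1 0 0 * x + γ.2.1.1 0 1 * y)
          (γ.2.1.1 1 0 * x + γ.2.1.1 1 1 * y) +
        repMat 1 γ.1 i 1 * frm (fun k => v (1, k)) (γ.2.1.1 0 0 * x + γ.2.1.1 0 1 * y)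
          (γ.2.1.1 1 0 * x + γ.2.1.1 1 1 * y)) := by
  have key : ∀ f : Fin 9 → ℂ, frm f (γ.2.1.1 0 0 * x + γ.2.1.1 0 1 * y)
          (γ.2.1.1 1 0 * x + γ.2.1.1 1 1 * y) =
        ∑ k : Fin 9, (∑ j : Fin 9, repMat 8 γ.2.1 k j * f j) * (x ^ (k : ℕ) * y ^ (8 - (k : ℕ))) := by
    intro f
    unfold frm
    have := fun j => repMat_eval 8 γ.2.1 j x y
    simp only [← this, Finset.mul_sum, Finset.sum_mul]
    rw [Finset.sum_comm]
    refine Finset.sum_congr rfl fun _ _ => Finset.sum_congr rfl fun _ _ => ?_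
    ring
  rw [key, key]
  unfold frm actP
  rw [Finset.mul_sum, Finset.mul_sum, ← Finset.sum_add_distrib, Finset.mul_sum]
  refine Finset.sum_congr rfl fun k _ => ?_
  have : ∑ q : Fin (1 + 1) × Fin (8 + 1), repMat 1 γ.1 i q.1 * repMat 8 γ.2.1 k q.2 * v q =
      repMat 1 γ.1 i 0 * (∑ j : Fin 9, repMat 8 γ.2.1 k j * v (0, j)) +
      repMat 1 γ.1 i 1 * (∑ j : Fin 9, repMat 8 γ.2.1 k j * v (1, j)) := by
    rw [Fintype.sum_prod_type, Fin.sum_univ_two, Finset.mul_sum, Finset.mul_sum]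
    congr 1 <;> exact Finset.sum_congr rfl fun _ _ => by ring
  dsimp only
  rw [this]; ring

lemma rel_act (γ : SL2 × SL2 × ℂˣ) (v : Pt) : PRel v (actP γ v) := by
  obtain ⟨h1, h2, h3, h4⟩ := repMat_one γ.1
  have d1 := γ.1.2
  have d2 := γ.2.1.2
  rw [Matrix.det_fin_two] at d1 d2
  have ht := γ.2.2.ne_zero
  refine ⟨γ.2.2 * γ.1.1 1 1, γ.2.2 * γ.1.1 0 1, γ.2.2 * γ.1.1 1 0, γ.2.2 * γ.1.1 0 0,
    γ.2.1.1 0 0, γ.2.1.1 0 1, γ.2.1.1 1 0, γ.2.1.1 1 1, ?_, ?_, ?_⟩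
  · have : γ.2.2 * γ.1.1 1 1 * (γ.2.2 * γ.1.1 0 0) - γ.2.2 * γ.1.1 0 1 * (γ.2.2 * γ.1.1 1 0)
      = (γ.2.2 : ℂ) ^ 2 := by linear_combination (γ.2.2 : ℂ) ^ 2 * d1
    rw [this]; exact pow_ne_zero _ ht
  · rw [d2]; exact one_ne_zero
  · intro x y
    rw [frm_act, frm_act, h1, h2, h3, h4]
    constructor <;> ring

lemma frm_smul (f : Fin 9 → ℂ) (s x y : ℂ) : frm f (s * x) (s * y) = s ^ 8 * frm f x y := by
  unfold frm
  rw [Finset.mul_sum]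
  refine Finset.sum_congr rfl fun k _ => ?_
  have : s ^ 8 = s ^ (k : ℕ) * s ^ (8 - (k : ℕ)) := by
    rw [← pow_add]; congr 1; omega
  rw [mul_pow, mul_pow, this]; ring

lemma act_rel {v w : Pt} (h : PRel v w) : ∃ γ, actP γ v = w := by
  obtain ⟨a, b, c, d, a', b', c', d', h1, h2, h3⟩ := h
  obtain ⟨s, hs⟩ := IsAlgClosed.exists_pow_nat_eq (a * d - b * c) (n := 2) (by norm_num)
  obtain ⟨u, hu⟩ := IsAlgClosed.exists_pow_nat_eq (a' * d' - b' * c') (n := 2) (by norm_num)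
  have hs0 : s ≠ 0 := by rintro rfl; apply h1; rw [← hs]; simp
  have hu0 : u ≠ 0 := by rintro rfl; apply h2; rw [← hu]; simp
  let g : SL2 := ⟨!![d / s, b / s; c / s, a / s], by
    rw [Matrix.det_fin_two_of]; field_simp; linear_combination -hs⟩
  let h : SL2 := ⟨!![a' / u, b' / u; c' / u, d' / u], by
    rw [Matrix.det_fin_two_of]; field_simp; linear_combination -hu⟩
  let t : ℂˣ := Units.mk0 (s * u ^ 8) (mul_ne_zero hs0 (pow_ne_zero _ hu0))
  refine ⟨(g, h, t), ?_⟩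
  have e : ∀ f x y, frm f (a' * x + b' * y) (c' * x + d' * y) =
      u ^ 8 * frm f (a' / u * x + b' / u * y) (c' / u * x + d' / u * y) := by
    intro f x y
    rw [← frm_smul]
    congr 1 <;> field_simp
  obtain ⟨k1, k2, k3, k4⟩ := repMat_one g
  have r0 : (fun k : Fin 9 => actP (g, h, t) v (0, k)) = fun k => w (0, k) := by
    apply frm_inj
    intro x y
    rw [frm_act, (h3 x y).1, e, e]
    simp only [k2, k4]
    simp [g, h, t]
    field_simp
  have r1 : (fun k : Fin 9 => actP (g, h, t) v (1, k)) = fun k => w (1, k) := by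
    apply frm_inj
    intro x y
    rw [frm_act, (h3 x y).2, e, e]
    simp only [k1, k3]
    simp [g, h, t]
    field_simp
  funext ⟨i, k⟩
  fin_cases i
  · exact congrFun r0 k
  · exact congrFun r1 k


/-- coefficients of the form `f(a x + b y, c x + d y)` -/
def rho (a b c d : ℂ) (f : Fin 9 → ℂ) (k : Fin 9) : ℂ :=
  ∑ j : Fin 9, f j * ∑ i ∈ Finset.range ((k : ℕ) + 1),
    (((j : ℕ).choose i : ℂ) * a ^ i * b ^ ((j : ℕ) - i)) *
    (((8 - (j : ℕ)).choose ((k : ℕ) - i) : ℂ) * c ^ ((k : ℕ) - i) *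
      d ^ (8 - (j : ℕ) - ((k : ℕ) - i)))

lemma rho_aux (a b c d x y : ℂ) (j : Fin 9) :
    ∑ k : Fin 9, (∑ i ∈ Finset.range ((k : ℕ) + 1),
    (((j : ℕ).choose i : ℂ) * a ^ i * b ^ ((j : ℕ) - i)) *
    (((8 - (j : ℕ)).choose ((k : ℕ) - i) : ℂ) * c ^ ((k : ℕ) - i) *
      d ^ (8 - (j : ℕ) - ((k : ℕ) - i)))) * (x ^ (k : ℕ) * y ^ (8 - (k : ℕ))) =
    (a * x + b * y) ^ (j : ℕ) * (c * x + d * y) ^ (8 - (j : ℕ)) := by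
  fin_cases j <;>
  · simp [Fin.sum_univ_succ, Finset.sum_range_succ, Nat.choose]
    ring

lemma frm_rho (a b c d : ℂ) (f : Fin 9 → ℂ) (x y : ℂ) :
    frm (rho a b c d f) x y = frm f (a * x + b * y) (c * x + d * y) := by
  unfold frm rho
  simp only [← rho_aux, Finset.mul_sum, Finset.sum_mul]
  rw [Finset.sum_comm]
  refine Finset.sum_congr rfl fun _ _ => Finset.sum_congr rfl fun _ _ =>
    Finset.sum_congr rfl fun _ _ => ?_
  ring

lemma rho_comp (a b c d a' b' c' d' : ℂ) (f : Fin 9 → ℂ) :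
    rho (a * a' + b * c') (a * b' + b * d') (c * a' + d * c') (c * b' + d * d') f =
      rho a' b' c' d' (rho a b c d f) := by
  apply frm_inj
  intro x y
  rw [frm_rho, frm_rho, frm_rho]
  congr 1 <;> ring

/-- minors -/
def mm (f g : Fin 9 → ℂ) (i j : Fin 9) : ℂ := f i * g j - f j * g i

def qp (f g : Fin 9 → ℂ) : ℂ := 28 * mm f g 8 1 - 7 * mm f g 7 2 + 3 * mm f g 6 3 - 2 * mm f g 5 4
def qz (f g : Fin 9 → ℂ) : ℂ := 224 * mm f g 8 0 - 21 * mm f g 7 1 + 4 * mm f g 6 2 - mm f g 5 3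
def qm (f g : Fin 9 → ℂ) : ℂ := 28 * mm f g 7 0 - 7 * mm f g 6 1 + 3 * mm f g 5 2 - 2 * mm f g 4 3

def Cov (a b c d : ℂ) : Prop := ∀ f g : Fin 9 → ℂ,
  qp (rho a b c d f) (rho a b c d g) =
    (a * d - b * c) ^ 7 * (qp f g * a ^ 2 + qz f g * (a * c) + qm f g * c ^ 2) ∧
  qz (rho a b c d f) (rho a b c d g) =
    (a * d - b * c) ^ 7 * (2 * qp f g * (a * b) + qz f g * (a * d + b * c) + 2 * qm f g * (c * d)) ∧
  qm (rho a b c d f) (rho a b c d g) =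
    (a * d - b * c) ^ 7 * (qp f g * b ^ 2 + qz f g * (b * d) + qm f g * d ^ 2)

lemma Cov.comp {a b c d a' b' c' d' : ℂ} (h : Cov a b c d) (h' : Cov a' b' c' d') :
    Cov (a * a' + b * c') (a * b' + b * d') (c * a' + d * c') (c * b' + d * d') := by
  intro f g
  rw [rho_comp, rho_comp]
  obtain ⟨k1, k2, k3⟩ := h' (rho a b c d f) (rho a b c d g)
  obtain ⟨l1, l2, l3⟩ := h f g
  rw [k1, k2, k3, l1, l2, l3]
  have : (a * a' + b * c') * (c * b' + d * d') - (a * b' + b * d') * (c * a' + d * c') =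
    (a * d - b * c) * (a' * d' - b' * c') := by ring
  rw [this, mul_pow]
  refine ⟨?_, ?_, ?_⟩ <;> ring

lemma rho_val (a b c d : ℂ) (f g : Fin 9 → ℂ) (h : ∀ x y, frm g x y = frm f (a * x + b * y) (c * x + d * y)) :
    rho a b c d f = g := by
  apply frm_inj
  intro x y
  rw [frm_rho, h]

lemma cov_diag (s t : ℂ) : Cov s 0 0 t := by
  have h : ∀ f, rho s 0 0 t f = ![f 0 * t ^ 8, f 1 * s * t ^ 7, f 2 * s ^ 2 * t ^ 6, f 3 * s ^ 3 * t ^ 5,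
      f 4 * s ^ 4 * t ^ 4, f 5 * s ^ 5 * t ^ 3, f 6 * s ^ 6 * t ^ 2, f 7 * s ^ 7 * t, f 8 * s ^ 8] := by
    intro f
    apply rho_val
    intro x y
    simp [frm, Fin.sum_univ_succ]
    ring
  intro f g
  rw [h, h]
  simp [qp, qz, qm, mm]
  refine ⟨?_, ?_, ?_⟩ <;> ring

lemma cov_swap : Cov 0 1 1 0 := by
  have h : ∀ f, rho 0 1 1 0 f = ![f 8, f 7, f 6, f 5, f 4, f 3, f 2, f 1, f 0] := by
    intro f
    apply rho_val
    intro x y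
    simp [frm, Fin.sum_univ_succ]
    ring
  intro f g
  rw [h, h]
  simp [qp, qz, qm, mm]
  refine ⟨?_, ?_, ?_⟩ <;> ring

lemma cov_up (t : ℂ) : Cov 1 t 0 1 := by
  have h : ∀ f, rho 1 t 0 1 f = ![
      f 0 + f 1 * t + f 2 * t ^ 2 + f 3 * t ^ 3 + f 4 * t ^ 4 + f 5 * t ^ 5 + f 6 * t ^ 6 + f 7 * t ^ 7 + f 8 * t ^ 8,
      f 1 + 2 * f 2 * t + 3 * f 3 * t ^ 2 + 4 * f 4 * t ^ 3 + 5 * f 5 * t ^ 4 + 6 * f 6 * t ^ 5 + 7 * f 7 * t ^ 6 + 8 * f 8 * t ^ 7,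
      f 2 + 3 * f 3 * t + 6 * f 4 * t ^ 2 + 10 * f 5 * t ^ 3 + 15 * f 6 * t ^ 4 + 21 * f 7 * t ^ 5 + 28 * f 8 * t ^ 6,
      f 3 + 4 * f 4 * t + 10 * f 5 * t ^ 2 + 20 * f 6 * t ^ 3 + 35 * f 7 * t ^ 4 + 56 * f 8 * t ^ 5,
      f 4 + 5 * f 5 * t + 15 * f 6 * t ^ 2 + 35 * f 7 * t ^ 3 + 70 * f 8 * t ^ 4,
      f 5 + 6 * f 6 * t + 21 * f 7 * t ^ 2 + 56 * f 8 * t ^ 3,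
      f 6 + 7 * f 7 * t + 28 * f 8 * t ^ 2,
      f 7 + 8 * f 8 * t,
      f 8] := by
    intro f
    apply rho_val
    intro x y
    simp [frm, Fin.sum_univ_succ]
    ring
  intro f g
  rw [h, h]
  simp [qp, qz, qm, mm]
  refine ⟨?_, ?_, ?_⟩ <;> ring

lemma cov_low (t : ℂ) : Cov 1 0 t 1 := by
  have := (cov_swap.comp (cov_up t)).comp cov_swap
  simpa using this

lemma cov_all (a b c d : ℂ) (h : a * d - b * c ≠ 0) : Cov a b c d := by
  have key : ∀ a b c d : ℂ, a ≠ 0 → Cov a b c d := by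
    intro a b c d ha
    have := ((cov_low (c / a)).comp (cov_diag a ((a * d - b * c) / a))).comp (cov_up (b / a))
    convert this using 1
    · ring
    · field_simp; ring
    · field_simp; ring
    · field_simp; ring
  by_cases ha : a = 0
  · have hc : c ≠ 0 := by
      rintro rfl
      simp [ha] at h
    have := cov_swap.comp (key c d a b hc)
    simpa using this
  · exact key a b c d ha


def Qz (m : Fin 9 → Fin 9 → ℂ) : ℂ := 224 * m 8 0 - 21 * m 7 1 + 4 * m 6 2 - m 5 3
def pP (m : Fin 9 → Fin 9 → ℂ) : ℂ := m 5 4 * m 3 4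
def sgS2 (e : ℂ) (m : Fin 9 → Fin 9 → ℂ) : ℂ := m 6 4 * m 3 4 ^ 2 + e * (m 2 4 * m 5 4 ^ 2)
def sgS3 (e : ℂ) (m : Fin 9 → Fin 9 → ℂ) : ℂ := m 7 4 * m 3 4 ^ 3 + e * (m 1 4 * m 5 4 ^ 3)
def sgS4 (e : ℂ) (m : Fin 9 → Fin 9 → ℂ) : ℂ := m 8 4 * m 3 4 ^ 4 + e * (m 0 4 * m 5 4 ^ 4)
def sgT2 (e : ℂ) (m : Fin 9 → Fin 9 → ℂ) : ℂ := m 5 6 * m 3 4 ^ 3 + e * (m 3 2 * m 5 4 ^ 3)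
def sgT3 (e : ℂ) (m : Fin 9 → Fin 9 → ℂ) : ℂ := m 5 7 * m 3 4 ^ 4 + e * (m 3 1 * m 5 4 ^ 4)
def Ex (m : Fin 9 → Fin 9 → ℂ) : ℂ := m 7 4 * m 1 4 * Qz m

def Qd (m : Fin 9 → Fin 9 → ℂ) : ℂ := pP m ^ 3 * sgS2 1 m ^ 3 * sgS2 (-1) m * Ex m

def nn (m : Fin 9 → Fin 9 → ℂ) : Fin 11 → ℂ := ![
  sgS2 1 m ^ 5 * sgS2 (-1) m * Ex m,
  sgS2 (-1) m ^ 3 * sgS2 1 m * pP m ^ 3 * Ex m,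
  sgS3 1 m * pP m ^ 4 * sgS2 1 m * sgS2 (-1) m * Ex m,
  sgS3 (-1) m * pP m ^ 4 * sgS2 1 m ^ 2 * Ex m,
  sgS4 1 m * pP m ^ 5 * sgS2 (-1) m * Ex m,
  sgS4 (-1) m * pP m ^ 5 * sgS2 1 m * Ex m,
  m 5 3 * pP m ^ 4 * sgS2 1 m ^ 3 * Ex m,
  sgT2 1 m * pP m ^ 4 * sgS2 1 m * sgS2 (-1) m * Ex m,
  sgT2 (-1) m * pP m ^ 4 * sgS2 1 m ^ 2 * Ex m,
  sgT3 1 m * pP m ^ 5 * sgS2 (-1) m * Ex m,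
  sgT3 (-1) m * pP m ^ 5 * sgS2 1 m * Ex m]

lemma scale_all (m m' : Fin 9 → Fin 9 → ℂ) (k t : ℂ)
    (h : ∀ i j, m' i j = k * (t ^ (i : ℕ) * t ^ (j : ℕ)) * m i j) :
    Qd m' = k ^ 21 * t ^ 168 * Qd m ∧ ∀ i, nn m' i = k ^ 21 * t ^ 168 * nn m i := by
  have hp : pP m' = k ^ 2 * t ^ 16 * pP m := by simp [pP, h]; ring
  have h2 : ∀ e, sgS2 e m' = k ^ 3 * t ^ 24 * sgS2 e m := by intro e; simp [sgS2, h]; ring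
  have h3 : ∀ e, sgS3 e m' = k ^ 4 * t ^ 32 * sgS3 e m := by intro e; simp [sgS3, h]; ring
  have h4 : ∀ e, sgS4 e m' = k ^ 5 * t ^ 40 * sgS4 e m := by intro e; simp [sgS4, h]; ring
  have k2 : ∀ e, sgT2 e m' = k ^ 4 * t ^ 32 * sgT2 e m := by intro e; simp [sgT2, h]; ring
  have k3 : ∀ e, sgT3 e m' = k ^ 5 * t ^ 40 * sgT3 e m := by intro e; simp [sgT3, h]; ring
  have he : Ex m' = k ^ 3 * t ^ 24 * Ex m := by simp [Ex, Qz, h]; ring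
  have h53 : m' 5 3 = k * t ^ 8 * m 5 3 := by rw [h 5 3]; norm_num; left; left; ring
  constructor
  · simp only [Qd, hp, h2, he]; ring
  · intro i
    fin_cases i <;> simp only [nn, hp, h2, h3, h4, k2, k3, he, h53] <;> simp <;> ring

lemma swap_all (m m' : Fin 9 → Fin 9 → ℂ) (ha : ∀ i j, m i j = - m j i)
    (h : ∀ i j, m' i j = m i.rev j.rev) :
    Qd m' = Qd m ∧ ∀ i, nn m' i = nn m i := by
  have r0 : (0 : Fin 9).rev = 8 := rfl
  have r1 : (1 : Fin 9).rev = 7 := rfl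
  have r2 : (2 : Fin 9).rev = 6 := rfl
  have r3 : (3 : Fin 9).rev = 5 := rfl
  have r4 : (4 : Fin 9).rev = 4 := rfl
  have r5 : (5 : Fin 9).rev = 3 := rfl
  have r6 : (6 : Fin 9).rev = 2 := rfl
  have r7 : (7 : Fin 9).rev = 1 := rfl
  have r8 : (8 : Fin 9).rev = 0 := rfl
  have hp : pP m' = pP m := by simp only [pP, h, r0, r1, r2, r3, r4, r5, r6, r7, r8]; ring
  have h2 : sgS2 1 m' = sgS2 1 m := by simp only [sgS2, h, r0, r1, r2, r3, r4, r5, r6, r7, r8]; ring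
  have h3 : sgS3 1 m' = sgS3 1 m := by simp only [sgS3, h, r0, r1, r2, r3, r4, r5, r6, r7, r8]; ring
  have h4 : sgS4 1 m' = sgS4 1 m := by simp only [sgS4, h, r0, r1, r2, r3, r4, r5, r6, r7, r8]; ring
  have k2 : sgT2 1 m' = sgT2 1 m := by simp only [sgT2, h, r0, r1, r2, r3, r4, r5, r6, r7, r8]; ring
  have k3 : sgT3 1 m' = sgT3 1 m := by simp only [sgT3, h, r0, r1, r2, r3, r4, r5, r6, r7, r8]; ring
  have h2' : sgS2 (-1) m' = - sgS2 (-1) m := by simp only [sgS2, h, r0, r1, r2, r3, r4, r5, r6, r7, r8]; ring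
  have h3' : sgS3 (-1) m' = - sgS3 (-1) m := by simp only [sgS3, h, r0, r1, r2, r3, r4, r5, r6, r7, r8]; ring
  have h4' : sgS4 (-1) m' = - sgS4 (-1) m := by simp only [sgS4, h, r0, r1, r2, r3, r4, r5, r6, r7, r8]; ring
  have k2' : sgT2 (-1) m' = - sgT2 (-1) m := by simp only [sgT2, h, r0, r1, r2, r3, r4, r5, r6, r7, r8]; ring
  have k3' : sgT3 (-1) m' = - sgT3 (-1) m := by simp only [sgT3, h, r0, r1, r2, r3, r4, r5, r6, r7, r8]; ring
  have he : Ex m' = - Ex m := by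
    simp only [Ex, Qz, h, r0, r1, r2, r3, r4, r5, r6, r7, r8]
    rw [ha 0 8, ha 1 7, ha 2 6, ha 3 5]; ring
  have h53 : m' 5 3 = - m 5 3 := by rw [h, r5, r3, ha]
  constructor
  · simp only [Qd, hp, h2, h2', he]; ring
  · intro i
    fin_cases i <;> simp only [nn, hp, h2, h3, h4, k2, k3, h2', h3', h4', k2', k3', he, h53] <;> simp <;> ring

def r0 (w : Pt) : Fin 9 → ℂ := fun k => w (0, k)
def r1 (w : Pt) : Fin 9 → ℂ := fun k => w (1, k)
def MM (w : Pt) : Fin 9 → Fin 9 → ℂ := mm (r0 w) (r1 w)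
def YY (w : Pt) : Prop := qp (r0 w) (r1 w) = 0 ∧ qm (r0 w) (r1 w) = 0

lemma frm_lin (a b : ℂ) (f g : Fin 9 → ℂ) (x y : ℂ) :
    frm (fun k => a * f k + b * g k) x y = a * frm f x y + b * frm g x y := by
  simp only [frm, Finset.mul_sum, ← Finset.sum_add_distrib]
  refine Finset.sum_congr rfl fun _ _ => ?_
  ring

lemma rel_rows {a b c d a' b' c' d' : ℂ} {v w : Pt} : RelBy a b c d a' b' c' d' v w ↔
    (r0 w = (fun k => a * rho a' b' c' d' (r0 v) k + b * rho a' b' c' d' (r1 v) k) ∧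
    r1 w = (fun k => c * rho a' b' c' d' (r0 v) k + d * rho a' b' c' d' (r1 v) k)) := by
  constructor
  · intro h
    constructor
    · apply frm_inj
      intro x y
      rw [frm_lin, frm_rho, frm_rho]
      exact (h x y).1
    · apply frm_inj
      intro x y
      rw [frm_lin, frm_rho, frm_rho]
      exact (h x y).2
  · rintro ⟨h1, h2⟩ x y
    have e1 : (fun k => w (0, k)) = r0 w := rfl
    have e2 : (fun k => w (1, k)) = r1 w := rfl
    have e3 : (fun k => v (0, k)) = r0 v := rfl
    have e4 : (fun k => v (1, k)) = r1 v := rfl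
    rw [e1, e2, e3, e4, h1, h2, frm_lin, frm_lin, frm_rho, frm_rho]
    exact ⟨rfl, rfl⟩

lemma mm_lin (a b c d : ℂ) (f g : Fin 9 → ℂ) (i j : Fin 9) :
    mm (fun k => a * f k + b * g k) (fun k => c * f k + d * g k) i j = (a * d - b * c) * mm f g i j := by
  simp only [mm]; ring

lemma rho_diag (s t : ℂ) (f : Fin 9 → ℂ) :
    rho s 0 0 t f = fun k => f k * (s ^ (k : ℕ) * t ^ (8 - (k : ℕ))) := by
  apply rho_val
  intro x y
  simp [frm, Fin.sum_univ_succ]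
  ring

lemma rho_anti (s t : ℂ) (f : Fin 9 → ℂ) :
    rho 0 s t 0 f = fun k : Fin 9 => f k.rev * (t ^ (k : ℕ) * s ^ (8 - (k : ℕ))) := by
  apply rho_val
  intro x y
  have r0 : (0 : Fin 9).rev = 8 := rfl
  have r1 : (1 : Fin 9).rev = 7 := rfl
  have r2 : (2 : Fin 9).rev = 6 := rfl
  have r3 : (3 : Fin 9).rev = 5 := rfl
  have r4 : (4 : Fin 9).rev = 4 := rfl
  have r5 : (5 : Fin 9).rev = 3 := rfl
  have r6 : (6 : Fin 9).rev = 2 := rfl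
  have r7 : (7 : Fin 9).rev = 1 := rfl
  have r8 : (8 : Fin 9).rev = 0 := rfl
  have hs : ∀ F : Fin 9 → ℂ, ∑ k, F k = F 0 + F 1 + F 2 + F 3 + F 4 + F 5 + F 6 + F 7 + F 8 := by
    intro F; simp [Fin.sum_univ_succ]; ring
  rw [frm, frm, hs, hs]
  rw [r0, r1, r2, r3, r4, r5, r6, r7, r8]
  simp
  ring

lemma pow_help (s t : ℂ) (ht : t ≠ 0) (k : Fin 9) :
    s ^ (k : ℕ) * t ^ (8 - (k : ℕ)) = t ^ 8 * (s / t) ^ (k : ℕ) := by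
  have : t ^ 8 = t ^ (8 - (k : ℕ)) * t ^ (k : ℕ) := by rw [← pow_add]; congr 1; omega
  rw [this, div_pow]
  field_simp

lemma lemA {w w' : Pt} (h : PRel w w') (hy : YY w) (hy' : YY w') (hq : Qd (MM w) ≠ 0) :
    Qd (MM w') ≠ 0 ∧ ∀ i, nn (MM w') i * Qd (MM w) = nn (MM w) i * Qd (MM w') := by
  obtain ⟨a, b, c, d, a', b', c', d', h1, h2, h3⟩ := h
  rw [rel_rows] at h3
  obtain ⟨e0, e1⟩ := h3
  have hM : ∀ i j, MM w' i j = (a * d - b * c) *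
      mm (rho a' b' c' d' (r0 w)) (rho a' b' c' d' (r1 w)) i j := by
    intro i j
    rw [MM, e0, e1, mm_lin]
  obtain ⟨c1, _, c3⟩ := cov_all a' b' c' d' h2 (r0 w) (r1 w)
  have hz : qz (r0 w) (r1 w) ≠ 0 := by
    intro h0
    apply hq
    have : Qz (MM w) = 0 := h0
    simp [Qd, Ex, this]
  have hac : a' * c' = 0 := by
    have : (a * d - b * c) * qp (rho a' b' c' d' (r0 w)) (rho a' b' c' d' (r1 w)) = 0 := by
      rw [← hy'.1]
      have := hM
      simp only [MM] at this
      simp only [qp, this]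
      ring
    rw [c1, hy.1, hy.2] at this
    have := (mul_eq_zero.mp ((mul_eq_zero.mp this).resolve_left h1)).resolve_left (pow_ne_zero _ h2)
    simpa [hz] using this
  have hbd : b' * d' = 0 := by
    have : (a * d - b * c) * qm (rho a' b' c' d' (r0 w)) (rho a' b' c' d' (r1 w)) = 0 := by
      rw [← hy'.2]
      have := hM
      simp only [MM] at this
      simp only [qm, this]
      ring
    rw [c3, hy.1, hy.2] at this
    have := (mul_eq_zero.mp ((mul_eq_zero.mp this).resolve_left h1)).resolve_left (pow_ne_zero _ h2)
    simpa [hz] using this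
  rcases mul_eq_zero.mp hac with h0 | h0
  · subst h0
    have hb : b' ≠ 0 := by rintro rfl; simp at h2
    have hc : c' ≠ 0 := by rintro rfl; simp at h2
    obtain rfl : d' = 0 := by simpa [hb] using hbd
    obtain ⟨s1, s2⟩ := swap_all (MM w) (fun i j => MM w i.rev j.rev)
      (fun i j => by simp [MM, mm]) (fun i j => rfl)
    obtain ⟨t1, t2⟩ := scale_all (fun i j => MM w i.rev j.rev) (MM w')
      ((a * d - b * c) * (b' ^ 8 * b' ^ 8)) (c' / b') (fun i j => by
        rw [hM, rho_anti, rho_anti]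
        simp only [mm, MM, pow_help _ _ hb]
        ring)
    rw [s1] at t1
    refine ⟨?_, ?_⟩
    · rw [t1]
      exact mul_ne_zero (by positivity) hq
    · intro i
      rw [t1, t2, s2]; ring
  · subst h0
    have ha : a' ≠ 0 := by rintro rfl; simp at h2
    have hd : d' ≠ 0 := by rintro rfl; simp at h2
    obtain rfl : b' = 0 := by simpa [hd] using hbd
    obtain ⟨t1, t2⟩ := scale_all (MM w) (MM w')
      ((a * d - b * c) * (d' ^ 8 * d' ^ 8)) (a' / d') (fun i j => by
        rw [hM, rho_diag, rho_diag]
        simp only [mm, MM, pow_help _ _ hd]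
        ring)
    refine ⟨?_, ?_⟩
    · rw [t1]
      exact mul_ne_zero (by positivity) hq
    · intro i
      rw [t1, t2]; ring

lemma rel_diag (al be ga de t : ℂ) (w w' : Pt) (h : al * de - be * ga ≠ 0) (ht : t ≠ 0)
    (h0 : ∀ k, w' (0, k) = (al * w (0, k) + be * w (1, k)) * t ^ (k : ℕ))
    (h1 : ∀ k, w' (1, k) = (ga * w (0, k) + de * w (1, k)) * t ^ (k : ℕ)) : PRel w w' := by
  refine ⟨al, be, ga, de, t, 0, 0, 1, h, by simpa using ht, ?_⟩
  rw [rel_rows]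
  constructor
  · funext k
    simp only [r0, r1, rho_diag, h0]
    simp
    ring
  · funext k
    simp only [r0, r1, rho_diag, h1]
    simp
    ring


def lam (β u3 v3 : ℂ) : ℂ := 28 * u3 * v3 * β ^ 3

def row0 (β u2 v2 u3 v3 u4 v4 : ℂ) : Fin 9 → ℂ :=
  ![v4 * β ^ 4, v3 * β ^ 3, v2 * β ^ 2, β, 0, 1, u2, u3, u4]

def row1 (β ε u2 v2 u3 v3 u4 v4 p2 q2 p3 q3 : ℂ) : Fin 9 → ℂ :=
  ![v3 * β ^ 3 * (28 * (v4 * β ^ 4) * p3 - (7 * (v3 * β ^ 3 * p2 - u2 * ((q3 + v3 * ε) * β ^ 3))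
      + 3 * ((q2 + v2 * ε) * β ^ 2) + 2 * β)),
    lam β u3 v3 * ((q3 + v3 * ε) * β ^ 3),
    lam β u3 v3 * ((q2 + v2 * ε) * β ^ 2),
    lam β u3 v3 * (ε * β),
    lam β u3 v3,
    0,
    lam β u3 v3 * p2,
    lam β u3 v3 * p3,
    u3 * (28 * u4 * ((q3 + v3 * ε) * β ^ 3) - (7 * (u3 * ((q2 + v2 * ε) * β ^ 2) - v2 * β ^ 2 * p3)
      - 3 * (u2 * (ε * β) - β * p2) + 2))]

def secw (β ε u2 v2 u3 v3 u4 v4 p2 q2 p3 q3 : ℂ) : Pt := fun p =>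
  if p.1 = 0 then row0 β u2 v2 u3 v3 u4 v4 p.2 else row1 β ε u2 v2 u3 v3 u4 v4 p2 q2 p3 q3 p.2

lemma r0_secw (β ε u2 v2 u3 v3 u4 v4 p2 q2 p3 q3 : ℂ) :
    r0 (secw β ε u2 v2 u3 v3 u4 v4 p2 q2 p3 q3) = row0 β u2 v2 u3 v3 u4 v4 := by
  funext k; simp [r0, secw]

lemma r1_secw (β ε u2 v2 u3 v3 u4 v4 p2 q2 p3 q3 : ℂ) :
    r1 (secw β ε u2 v2 u3 v3 u4 v4 p2 q2 p3 q3) = row1 β ε u2 v2 u3 v3 u4 v4 p2 q2 p3 q3 := by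
  funext k; simp [r1, secw]

lemma YY_secw (β ε u2 v2 u3 v3 u4 v4 p2 q2 p3 q3 : ℂ) :
    YY (secw β ε u2 v2 u3 v3 u4 v4 p2 q2 p3 q3) := by
  rw [YY, r0_secw, r1_secw]
  constructor
  · simp [qp, mm, row0, row1, lam]; ring
  · simp [qm, mm, row0, row1, lam]; ring

lemma MM_secw (β ε u2 v2 u3 v3 u4 v4 p2 q2 p3 q3 : ℂ) :
    ∃ m, MM (secw β ε u2 v2 u3 v3 u4 v4 p2 q2 p3 q3) = m ∧
    m 5 4 = lam β u3 v3 ∧ m 3 4 = lam β u3 v3 * β ∧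
    m 6 4 = lam β u3 v3 * u2 ∧ m 2 4 = lam β u3 v3 * (v2 * β ^ 2) ∧
    m 7 4 = lam β u3 v3 * u3 ∧ m 1 4 = lam β u3 v3 * (v3 * β ^ 3) ∧
    m 8 4 = lam β u3 v3 * u4 ∧ m 0 4 = lam β u3 v3 * (v4 * β ^ 4) ∧
    m 5 6 = lam β u3 v3 * p2 ∧ m 3 2 = lam β u3 v3 * (q2 * β ^ 3) ∧
    m 5 7 = lam β u3 v3 * p3 ∧ m 3 1 = lam β u3 v3 * (q3 * β ^ 4) ∧
    m 5 3 = lam β u3 v3 * (ε * β) := by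
  refine ⟨_, rfl, ?_⟩
  rw [MM, r0_secw, r1_secw]
  refine ⟨?_, ?_, ?_, ?_, ?_, ?_, ?_, ?_, ?_, ?_, ?_, ?_, ?_⟩ <;>
  · simp [mm, row0, row1] <;> ring

def Sec (y : Fin 11 → ℂ) (r : ℂ) : Pt :=
  secw (y 0) (r * y 6) ((1 + r) / 2) ((1 - r) / 2) ((y 2 + r * y 3) / 2) ((y 2 - r * y 3) / 2)
    ((y 4 + r * y 5) / 2) ((y 4 - r * y 5) / 2) ((y 7 + r * y 8) / 2) ((y 7 - r * y 8) / 2)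
    ((y 9 + r * y 10) / 2) ((y 9 - r * y 10) / 2)

lemma lemC0 (y : Fin 11 → ℂ) (r : ℂ) : ∃ l : ℂ,
    pP (MM (Sec y r)) = l ^ 2 * y 0 ∧
    sgS2 1 (MM (Sec y r)) = l ^ 3 * y 0 ^ 2 ∧ sgS2 (-1) (MM (Sec y r)) = l ^ 3 * y 0 ^ 2 * r ∧
    sgS3 1 (MM (Sec y r)) = l ^ 4 * y 0 ^ 3 * y 2 ∧ sgS3 (-1) (MM (Sec y r)) = l ^ 4 * y 0 ^ 3 * (r * y 3) ∧
    sgS4 1 (MM (Sec y r)) = l ^ 5 * y 0 ^ 4 * y 4 ∧ sgS4 (-1) (MM (Sec y r)) = l ^ 5 * y 0 ^ 4 * (r * y 5) ∧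
    sgT2 1 (MM (Sec y r)) = l ^ 4 * y 0 ^ 3 * y 7 ∧ sgT2 (-1) (MM (Sec y r)) = l ^ 4 * y 0 ^ 3 * (r * y 8) ∧
    sgT3 1 (MM (Sec y r)) = l ^ 5 * y 0 ^ 4 * y 9 ∧ sgT3 (-1) (MM (Sec y r)) = l ^ 5 * y 0 ^ 4 * (r * y 10) ∧
    MM (Sec y r) 5 3 = l * (r * y 6 * y 0) := by
  obtain ⟨m, h, h54, h34, h64, h24, h74, h14, h84, h04, h56, h32, h57, h31, h53⟩ :=
    MM_secw (y 0) (r * y 6) ((1 + r) / 2) ((1 - r) / 2) ((y 2 + r * y 3) / 2) ((y 2 - r * y 3) / 2)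
    ((y 4 + r * y 5) / 2) ((y 4 - r * y 5) / 2) ((y 7 + r * y 8) / 2) ((y 7 - r * y 8) / 2)
    ((y 9 + r * y 10) / 2) ((y 9 - r * y 10) / 2)
  rw [Sec, h]
  refine ⟨lam (y 0) ((y 2 + r * y 3) / 2) ((y 2 - r * y 3) / 2), ?_⟩
  generalize lam (y 0) ((y 2 + r * y 3) / 2) ((y 2 - r * y 3) / 2) = l at *
  simp only [pP, sgS2, sgS3, sgS4, sgT2, sgT3, h54, h34, h64, h24, h74, h14, h84, h04, h56, h32, h57, h31, h53]
  refine ⟨?_, ?_, ?_, ?_, ?_, ?_, ?_, ?_, ?_, ?_, ?_, ?_⟩ <;> first | trivial | ring1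

lemma lemC (y : Fin 11 → ℂ) (r : ℂ) (hr : r ^ 2 = y 1) (i : Fin 11) :
    nn (MM (Sec y r)) i = y i * Qd (MM (Sec y r)) := by
  obtain ⟨l, e1, e2, e3, e4, e5, e6, e7, e8, e9, e10, e11, e12⟩ := lemC0 y r
  simp only [nn, Qd, e1, e2, e3, e4, e5, e6, e7, e8, e9, e10, e11, e12]
  generalize Ex (MM (Sec y r)) = E
  fin_cases i <;> simp [← hr] <;> ring

lemma eq_of_YY (w1 w2 : Pt) (h1 : YY w1) (h2 : YY w2) (h0 : ∀ k, w1 (0, k) = w2 (0, k))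
    (h : ∀ k, k ≠ 0 → k ≠ 8 → w1 (1, k) = w2 (1, k)) (n1 : w1 (0, 1) ≠ 0) (n7 : w1 (0, 7) ≠ 0) :
    w1 = w2 := by
  obtain ⟨a1, b1⟩ := h1
  obtain ⟨a2, b2⟩ := h2
  simp only [qp, qm, mm, r0, r1] at a1 b1 a2 b2
  rw [← h 1 (by decide) (by decide), ← h 2 (by decide) (by decide), ← h 3 (by decide) (by decide),
    ← h 4 (by decide) (by decide), ← h 5 (by decide) (by decide), ← h 6 (by decide) (by decide),
    ← h 7 (by decide) (by decide)] at a2 b2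
  simp only [← h0] at a2 b2
  have e8 : w1 (1, 8) = w2 (1, 8) := by
    apply mul_left_cancel₀ n1
    linear_combination (a2 - a1) / 28
  have e0 : w1 (1, 0) = w2 (1, 0) := by
    apply mul_left_cancel₀ n7
    linear_combination (b1 - b2) / 28
  funext ⟨i, k⟩
  have hi : i = 0 ∨ i = 1 := by
    revert i; decide
  rcases hi with rfl | rfl
  · exact h0 k
  · by_cases k0 : k = 0
    · subst k0; exact e0
    · by_cases k8 : k = 8
      · subst k8; exact e8
      · exact h k k0 k8

lemma lemD0 (w : Pt) (hy : YY w) (a b S : ℂ) (ha' : MM w 5 4 = a) (hb' : MM w 3 4 = b)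
    (ha : a ≠ 0) (hb : b ≠ 0) (hS : S ≠ 0) (h7 : MM w 7 4 ≠ 0) (h1 : MM w 1 4 ≠ 0) :
    PRel w (secw (S ^ 2 / (a * b) ^ 3) (MM w 5 3 * (a * b) / S) (MM w 6 4 * b ^ 2 / S) (MM w 2 4 * a ^ 2 / S)
      (a * b * MM w 7 4 * b ^ 3 / S ^ 2) (a * b * MM w 1 4 * a ^ 3 / S ^ 2)
      ((a * b) ^ 2 * MM w 8 4 * b ^ 4 / S ^ 3) ((a * b) ^ 2 * MM w 0 4 * a ^ 4 / S ^ 3)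
      (a * b * MM w 5 6 * b ^ 3 / S ^ 2) (a * b * MM w 3 2 * a ^ 3 / S ^ 2)
      ((a * b) ^ 2 * MM w 5 7 * b ^ 4 / S ^ 3) ((a * b) ^ 2 * MM w 3 1 * a ^ 4 / S ^ 3)) := by
  set β := S ^ 2 / (a * b) ^ 3 with hβ
  set u3 := a * b * MM w 7 4 * b ^ 3 / S ^ 2 with hu3
  set v3 := a * b * MM w 1 4 * a ^ 3 / S ^ 2 with hv3
  have hl : lam β u3 v3 ≠ 0 := by
    simp only [lam, hβ, hu3, hv3]
    exact mul_ne_zero (mul_ne_zero (mul_ne_zero (by norm_num) (by positivity)) (by positivity)) (by positivity)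
  have p1 : a * MM w 3 1 + MM w 1 4 * MM w 5 3 = b * MM w 5 1 := by
    rw [← ha', ← hb']; simp only [MM, mm]; ring
  have p2 : a * MM w 3 2 + MM w 2 4 * MM w 5 3 = b * MM w 5 2 := by
    rw [← ha', ← hb']; simp only [MM, mm]; ring
  set l := lam β u3 v3 with hl'
  set t := a * b ^ 2 / S with ht
  have ht0 : t ≠ 0 := by rw [ht]; positivity
  set s := S / (a ^ 2 * b ^ 2) with hs
  have hs0 : s ≠ 0 := by rw [hs]; positivity
  let al := s / t ^ 4 * r1 w 4
  let be := - (s / t ^ 4 * r0 w 4)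
  let ga := - (l / t ^ 4 / a * r1 w 5)
  let de := l / t ^ 4 / a * r0 w 5
  let w1 : Pt := fun p => if p.1 = 0 then (al * w (0, p.2) + be * w (1, p.2)) * t ^ (p.2 : ℕ)
    else (ga * w (0, p.2) + de * w (1, p.2)) * t ^ (p.2 : ℕ)
  have hdet : al * de - be * ga ≠ 0 := by
    have : al * de - be * ga = s / t ^ 4 * (l / t ^ 4 / a) * a := by
      have ha2 : r0 w 5 * r1 w 4 - r0 w 4 * r1 w 5 = a := ha'
      simp only [al, be, ga, de]
      linear_combination s / t ^ 4 * (l / t ^ 4 / a) * ha2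
    rw [this]
    positivity
  have hrel : PRel w w1 := rel_diag al be ga de t w w1 hdet ht0
    (fun k => by simp [w1]) (fun k => by simp [w1])
  have hM : ∀ i j, MM w1 i j = (al * de - be * ga) * (t ^ (i : ℕ) * t ^ (j : ℕ)) * MM w i j := by
    intro i j
    simp [MM, mm, r0, r1, w1]; ring
  have hY1 : YY w1 := by
    obtain ⟨y1, y2⟩ := hy
    have h : ∀ i j, mm (r0 w1) (r1 w1) i j =
      (al * de - be * ga) * (t ^ (i : ℕ) * t ^ (j : ℕ)) * mm (r0 w) (r1 w) i j := hM
    constructor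
    · rw [qp, h, h, h, h]
      rw [qp] at y1
      norm_num
      linear_combination (al * de - be * ga) * t ^ 9 * y1
    · rw [qm, h, h, h, h]
      rw [qm] at y2
      norm_num
      linear_combination (al * de - be * ga) * t ^ 7 * y2
  have e0 : ∀ k, w1 (0, k) = s / t ^ 4 * t ^ (k : ℕ) * MM w k 4 := by
    intro k
    simp [w1, al, be, MM, mm, r0, r1]; ring
  have e1 : ∀ k, w1 (1, k) = l / t ^ 4 / a * t ^ (k : ℕ) * MM w 5 k := by
    intro k
    simp [w1, ga, de, MM, mm, r0, r1]; ring
  have n1 : w1 (0, 1) ≠ 0 := by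
    rw [e0]; positivity
  have n7 : w1 (0, 7) ≠ 0 := by
    rw [e0]; positivity
  have m44 : MM w 4 4 = 0 := by simp [MM, mm]
  have m55 : MM w 5 5 = 0 := by simp [MM, mm]
  have q1 : MM w 5 1 = (a * MM w 3 1 + MM w 1 4 * MM w 5 3) / b := by rw [p1]; field_simp
  have q2 : MM w 5 2 = (a * MM w 3 2 + MM w 2 4 * MM w 5 3) / b := by rw [p2]; field_simp
  convert hrel using 1
  symm
  refine eq_of_YY _ _ hY1 (YY_secw _ _ _ _ _ _ _ _ _ _ _ _) ?_ ?_ n1 n7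
  · intro k
    rw [e0]
    fin_cases k <;> simp [secw, row0] <;> simp only [hs, ht, hβ, hu3, hv3, m44, ha', hb'] <;> field_simp <;> simp
  · intro k k0 k8
    rw [e1]
    fin_cases k
    · exact absurd rfl k0
    · simp [secw, row1, ← hl']; rw [q1]; clear_value l; simp only [hs, ht, hβ, hu3, hv3]; field_simp
    · simp [secw, row1, ← hl']; rw [q2]; clear_value l; simp only [hs, ht, hβ, hu3, hv3]; field_simp
    · simp [secw, row1, ← hl']; clear_value l; simp only [hs, ht, hβ, hu3, hv3]; field_simp
    · simp [secw, row1, ← hl']; clear_value l; rw [ha']; field_simp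
    · simp [secw, row1, ← hl']; clear_value l; simp [m55]
    · simp [secw, row1, ← hl']; clear_value l; simp only [hs, ht, hβ, hu3, hv3]; field_simp
    · simp [secw, row1, ← hl']; clear_value l; simp only [hs, ht, hβ, hu3, hv3]; field_simp
    · exact absurd rfl k8

lemma lemD (w : Pt) (hy : YY w) (hq : Qd (MM w) ≠ 0) :
    PRel w (Sec (fun i => nn (MM w) i / Qd (MM w)) (sgS2 (-1) (MM w) / sgS2 1 (MM w))) := by
  have hq' := hq
  simp only [Qd, Ex, pP] at hq'
  have ha : MM w 5 4 ≠ 0 := by intro h; simp [h] at hq'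
  have hb : MM w 3 4 ≠ 0 := by intro h; simp [h] at hq'
  have h7 : MM w 7 4 ≠ 0 := by intro h; simp [h] at hq'
  have h1 : MM w 1 4 ≠ 0 := by intro h; simp [h] at hq'
  have hS : sgS2 1 (MM w) ≠ 0 := by intro h; simp [h] at hq'
  have hD : sgS2 (-1) (MM w) ≠ 0 := by intro h; simp [h] at hq'
  have hz : Qz (MM w) ≠ 0 := by intro h; simp [h] at hq'
  have hE : Ex (MM w) ≠ 0 := mul_ne_zero (mul_ne_zero h7 h1) hz
  have key := lemD0 w hy _ _ _ rfl rfl ha hb hS h7 h1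
  convert key using 1
  have eS : sgS2 1 (MM w) = MM w 6 4 * MM w 3 4 ^ 2 + MM w 2 4 * MM w 5 4 ^ 2 := by simp [sgS2]
  have eD : sgS2 (-1) (MM w) = MM w 6 4 * MM w 3 4 ^ 2 - MM w 2 4 * MM w 5 4 ^ 2 := by simp [sgS2]; ring
  have eS' : MM w 6 4 * MM w 3 4 ^ 2 = (sgS2 1 (MM w) + sgS2 (-1) (MM w)) / 2 := by rw [eS, eD]; ring
  have eD' : MM w 2 4 * MM w 5 4 ^ 2 = (sgS2 1 (MM w) - sgS2 (-1) (MM w)) / 2 := by rw [eS, eD]; ring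
  rw [eS', eD', Sec]
  simp only [nn, Qd, sgS3, sgS4, sgT2, sgT3, pP]
  clear eS' eD' eS eD hq hq' key
  generalize Ex (MM w) = E at *
  generalize sgS2 1 (MM w) = S at *
  generalize sgS2 (-1) (MM w) = D at *
  generalize MM w = m at *
  congr 1 <;> (try simp) <;> field_simp <;> ring


section closure
variable {σ : Type} {δ : MvPolynomial σ ℂ}

lemma bb_add {f g : TT δ → ℂ} (hf : (fun x => f x) ∈ BB δ) (hg : (fun x => g x) ∈ BB δ) :
    (fun x => f x + g x) ∈ BB δ := (BB δ).add_mem hf hg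
lemma bb_sub {f g : TT δ → ℂ} (hf : (fun x => f x) ∈ BB δ) (hg : (fun x => g x) ∈ BB δ) :
    (fun x => f x - g x) ∈ BB δ := (BB δ).sub_mem hf hg
lemma bb_mul {f g : TT δ → ℂ} (hf : (fun x => f x) ∈ BB δ) (hg : (fun x => g x) ∈ BB δ) :
    (fun x => f x * g x) ∈ BB δ := (BB δ).mul_mem hf hg
lemma bb_neg {f : TT δ → ℂ} (hf : (fun x => f x) ∈ BB δ) :
    (fun x => - f x) ∈ BB δ := (BB δ).neg_mem hf
lemma bb_pow {f : TT δ → ℂ} (n : ℕ) (hf : (fun x => f x) ∈ BB δ) :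
    (fun x => f x ^ n) ∈ BB δ := (BB δ).pow_mem hf n
lemma bb_const (c : ℂ) : (fun _ : TT δ => c) ∈ BB δ := (BB δ).algebraMap_mem c
lemma bb_div {f : TT δ → ℂ} (c : ℂ) (hf : (fun x => f x) ∈ BB δ) :
    (fun x => f x / c) ∈ BB δ := by
  simp only [div_eq_mul_inv]
  exact bb_mul hf (bb_const _)
lemma bb_sum {κ : Type} (s : Finset κ) {f : κ → TT δ → ℂ} (hf : ∀ i, (fun x => f i x) ∈ BB δ) :
    (fun x => ∑ i ∈ s, f i x) ∈ BB δ := by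
  have := (BB δ).sum_mem (t := s) (f := f) (fun i _ => hf i)
  convert this using 1
  funext x
  simp

lemma bb_rho {a b c d : TT δ → ℂ} {f : TT δ → Fin 9 → ℂ} (ha : (fun x => a x) ∈ BB δ)
    (hb : (fun x => b x) ∈ BB δ) (hc : (fun x => c x) ∈ BB δ) (hd : (fun x => d x) ∈ BB δ)
    (hf : ∀ k, (fun x => f x k) ∈ BB δ) (k : Fin 9) :
    (fun x => rho (a x) (b x) (c x) (d x) (f x) k) ∈ BB δ := by
  unfold rho
  refine bb_sum _ fun j => bb_mul (hf j) (bb_sum _ fun i => ?_)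
  exact bb_mul (bb_mul (bb_mul (bb_const _) (bb_pow _ ha)) (bb_pow _ hb))
    (bb_mul (bb_mul (bb_const _) (bb_pow _ hc)) (bb_pow _ hd))

lemma bb_MM {w : TT δ → Pt} (hw : ∀ p, (fun x => w x p) ∈ BB δ) (i j : Fin 9) :
    (fun x => MM (w x) i j) ∈ BB δ :=
  bb_sub (bb_mul (hw _) (hw _)) (bb_mul (hw _) (hw _))

lemma bb_Qd {m : TT δ → Fin 9 → Fin 9 → ℂ} (h : ∀ i j, (fun x => m x i j) ∈ BB δ) :
    (fun x => Qd (m x)) ∈ BB δ := by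
  unfold Qd pP sgS2 Ex Qz
  repeat' (first | exact h _ _ | exact bb_const _ | refine bb_mul ?_ ?_ | refine bb_add ?_ ?_ |
    refine bb_sub ?_ ?_ | refine bb_pow _ ?_)

lemma bb_nn {m : TT δ → Fin 9 → Fin 9 → ℂ} (h : ∀ i j, (fun x => m x i j) ∈ BB δ) (i : Fin 11) :
    (fun x => nn (m x) i) ∈ BB δ := by
  have hp : (fun x => pP (m x)) ∈ BB δ := bb_mul (h _ _) (h _ _)
  have he : (fun x => Ex (m x)) ∈ BB δ := by
    unfold Ex Qz
    repeat' (first | exact h _ _ | exact bb_const _ | refine bb_mul ?_ ?_ | refine bb_add ?_ ?_ |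
      refine bb_sub ?_ ?_ | refine bb_pow _ ?_)
  have h2 : ∀ e, (fun x => sgS2 e (m x)) ∈ BB δ := by
    intro e; unfold sgS2
    repeat' (first | exact h _ _ | exact bb_const _ | refine bb_mul ?_ ?_ | refine bb_add ?_ ?_ | refine bb_pow _ ?_)
  have h3 : ∀ e, (fun x => sgS3 e (m x)) ∈ BB δ := by
    intro e; unfold sgS3
    repeat' (first | exact h _ _ | exact bb_const _ | refine bb_mul ?_ ?_ | refine bb_add ?_ ?_ | refine bb_pow _ ?_)
  have h4 : ∀ e, (fun x => sgS4 e (m x)) ∈ BB δ := by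
    intro e; unfold sgS4
    repeat' (first | exact h _ _ | exact bb_const _ | refine bb_mul ?_ ?_ | refine bb_add ?_ ?_ | refine bb_pow _ ?_)
  have k2 : ∀ e, (fun x => sgT2 e (m x)) ∈ BB δ := by
    intro e; unfold sgT2
    repeat' (first | exact h _ _ | exact bb_const _ | refine bb_mul ?_ ?_ | refine bb_add ?_ ?_ | refine bb_pow _ ?_)
  have k3 : ∀ e, (fun x => sgT3 e (m x)) ∈ BB δ := by
    intro e; unfold sgT3
    repeat' (first | exact h _ _ | exact bb_const _ | refine bb_mul ?_ ?_ | refine bb_add ?_ ?_ | refine bb_pow _ ?_)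
  fin_cases i <;> simp only [nn] <;> simp <;>
  repeat' (first | exact h _ _ | exact hp | exact he | exact h2 _ | exact h3 _ | exact h4 _ | exact k2 _ | exact k3 _ |
    refine bb_mul ?_ ?_ | refine bb_pow _ ?_)

lemma bb_Sec {y : Fin 11 → TT δ → ℂ} {r : TT δ → ℂ} (hy : ∀ i, (fun x => y i x) ∈ BB δ)
    (hr : (fun x => r x) ∈ BB δ) (p : Fin (1 + 1) × Fin (8 + 1)) :
    (fun x => Sec (fun i => y i x) (r x) p) ∈ BB δ := by
  obtain ⟨i, k⟩ := p
  unfold Sec secw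
  by_cases hi : i = 0
  · simp only [hi, if_true]
    fin_cases k <;> simp only [row0] <;> simp <;>
    repeat' (first | exact hy _ | exact hr | exact bb_const _ | refine bb_mul ?_ ?_ | refine bb_add ?_ ?_ |
      refine bb_sub ?_ ?_ | refine bb_pow _ ?_ | refine bb_div _ ?_)
  · simp only [hi, if_false]
    fin_cases k <;> simp only [row1, lam] <;> simp <;>
    repeat' (first | exact hy _ | exact hr | exact bb_const _ | refine bb_mul ?_ ?_ | refine bb_add ?_ ?_ |
      refine bb_sub ?_ ?_ | refine bb_pow _ ?_ | refine bb_div _ ?_)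

end closure

/-- the normalized representative -/
def Wt (v : Pt) (r : ℂ) : Pt := fun p =>
  rho (- qz (r0 v) (r1 v) + r) (- qz (r0 v) (r1 v) - r) (2 * qp (r0 v) (r1 v)) (2 * qp (r0 v) (r1 v))
    (if p.1 = 0 then r0 v else r1 v) p.2

def dl (v : Pt) : ℂ := qz (r0 v) (r1 v) ^ 2 - 4 * qp (r0 v) (r1 v) * qm (r0 v) (r1 v)

lemma r0_Wt (v : Pt) (r : ℂ) : r0 (Wt v r) =
    rho (- qz (r0 v) (r1 v) + r) (- qz (r0 v) (r1 v) - r) (2 * qp (r0 v) (r1 v)) (2 * qp (r0 v) (r1 v)) (r0 v) := by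
  funext k
  simp [r0, Wt]

lemma r1_Wt (v : Pt) (r : ℂ) : r1 (Wt v r) =
    rho (- qz (r0 v) (r1 v) + r) (- qz (r0 v) (r1 v) - r) (2 * qp (r0 v) (r1 v)) (2 * qp (r0 v) (r1 v)) (r1 v) := by
  funext k
  simp [r1, Wt]

lemma rel_rho (a b c d : ℂ) (h : a * d - b * c ≠ 0) (v w : Pt) (h0 : r0 w = rho a b c d (r0 v))
    (h1 : r1 w = rho a b c d (r1 v)) : PRel v w := by
  refine ⟨1, 0, 0, 1, a, b, c, d, by norm_num, h, ?_⟩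
  rw [rel_rows, h0, h1]
  constructor <;> funext k <;> ring

lemma Wt_det (v : Pt) (r : ℂ) (hq : qp (r0 v) (r1 v) ≠ 0) (hr : r ≠ 0) :
    (- qz (r0 v) (r1 v) + r) * (2 * qp (r0 v) (r1 v)) - (- qz (r0 v) (r1 v) - r) * (2 * qp (r0 v) (r1 v)) ≠ 0 := by
  have : (- qz (r0 v) (r1 v) + r) * (2 * qp (r0 v) (r1 v)) - (- qz (r0 v) (r1 v) - r) * (2 * qp (r0 v) (r1 v)) =
    4 * r * qp (r0 v) (r1 v) := by ring
  rw [this]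
  exact mul_ne_zero (mul_ne_zero (by norm_num) hr) hq

lemma Wt_rel (v : Pt) (r : ℂ) (hq : qp (r0 v) (r1 v) ≠ 0) (hr : r ≠ 0) : PRel v (Wt v r) :=
  rel_rho _ _ _ _ (Wt_det v r hq hr) _ _ (r0_Wt v r) (r1_Wt v r)

lemma Wt_YY (v : Pt) (r : ℂ) (hq : qp (r0 v) (r1 v) ≠ 0) (hr : r ≠ 0) (h : r ^ 2 = dl v) : YY (Wt v r) := by
  obtain ⟨c1, _, c3⟩ := cov_all _ _ _ _ (Wt_det v r hq hr) (r0 v) (r1 v)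
  rw [← r0_Wt, ← r1_Wt] at c1 c3
  rw [dl] at h
  constructor
  · rw [c1]
    apply mul_eq_zero_of_right
    linear_combination (qp (r0 v) (r1 v)) * h
  · rw [c3]
    apply mul_eq_zero_of_right
    linear_combination (qp (r0 v) (r1 v)) * h

def Mp (i j : Fin 9) : MvPolynomial (Fin (1 + 1) × Fin (8 + 1)) ℂ := X (0, i) * X (1, j) - X (0, j) * X (1, i)
def qpP : MvPolynomial (Fin (1 + 1) × Fin (8 + 1)) ℂ :=
  C 28 * Mp 8 1 - C 7 * Mp 7 2 + C 3 * Mp 6 3 - C 2 * Mp 5 4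
def qzP : MvPolynomial (Fin (1 + 1) × Fin (8 + 1)) ℂ :=
  C 224 * Mp 8 0 - C 21 * Mp 7 1 + C 4 * Mp 6 2 - Mp 5 3
def qmP : MvPolynomial (Fin (1 + 1) × Fin (8 + 1)) ℂ :=
  C 28 * Mp 7 0 - C 7 * Mp 6 1 + C 3 * Mp 5 2 - C 2 * Mp 4 3
def dP : MvPolynomial (Fin (1 + 1) × Fin (8 + 1)) ℂ := qzP ^ 2 - C 4 * qpP * qmP

lemma eval_Mp (v : Pt) (i j : Fin 9) : eval v (Mp i j) = mm (r0 v) (r1 v) i j := by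
  simp [Mp, mm, r0, r1]
lemma eval_qpP (v : Pt) : eval v qpP = qp (r0 v) (r1 v) := by
  simp only [qpP, map_add, map_sub, map_mul, eval_C, eval_Mp, qp]
lemma eval_qzP (v : Pt) : eval v qzP = qz (r0 v) (r1 v) := by
  simp only [qzP, map_add, map_sub, map_mul, eval_C, eval_Mp, qz]
lemma eval_qmP (v : Pt) : eval v qmP = qm (r0 v) (r1 v) := by
  simp only [qmP, map_add, map_sub, map_mul, eval_C, eval_Mp, qm]
lemma eval_dP (v : Pt) : eval v dP = dl v := by
  simp only [dP, map_pow, map_sub, map_mul, eval_C, eval_qpP, eval_qzP, eval_qmP, dl]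

lemma bb_Wt (p : Fin (1 + 1) × Fin (8 + 1)) : (fun x : TT dP => Wt x.1.1 x.1.2 p) ∈ BB dP := by
  have h1 : (fun x : TT dP => qp (r0 x.1.1) (r1 x.1.1)) ∈ BB dP := by
    have := BB_fst dP qpP
    simpa only [eval_qpP] using this
  have h2 : (fun x : TT dP => qz (r0 x.1.1) (r1 x.1.1)) ∈ BB dP := by
    have := BB_fst dP qzP
    simpa only [eval_qzP] using this
  have h3 : (fun x : TT dP => x.1.2) ∈ BB dP := BB_snd dP
  unfold Wt
  refine bb_rho (bb_add (bb_neg h2) h3) (bb_sub (bb_neg h2) h3) (bb_mul (bb_const _) h1) (bb_mul (bb_const _) h1) ?_ _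
  intro k
  by_cases hp : p.1 = 0
  · simp only [hp, if_true]
    have := BB_fst dP (X (0, k))
    simpa only [eval_X, r0, r1] using this
  · simp only [hp, if_false]
    have := BB_fst dP (X (1, k))
    simpa only [eval_X, r0, r1] using this


lemma sq_exists (z : ℂ) : ∃ r : ℂ, r ^ 2 = z := IsAlgClosed.exists_pow_nat_eq z (by norm_num)

/-- existence of numerator and denominator polynomials -/
lemma exists_ND : ∃ (N : Fin 11 → MvPolynomial (Fin (1 + 1) × Fin (8 + 1)) ℂ)
    (D : MvPolynomial (Fin (1 + 1) × Fin (8 + 1)) ℂ),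
    (∀ v r, r ^ 2 = dl v → qp (r0 v) (r1 v) ≠ 0 → r ≠ 0 → Qd (MM (Wt v r)) ≠ 0 → eval v D ≠ 0) ∧
    (∀ v r, r ^ 2 = dl v → eval v D ≠ 0 → qp (r0 v) (r1 v) ≠ 0 ∧ r ≠ 0 ∧ Qd (MM (Wt v r)) ≠ 0 ∧
      ∀ i, eval v (N i) / eval v D = nn (MM (Wt v r)) i / Qd (MM (Wt v r))) := by
  have hpre : (fun x : TT dP => eval x.1.1 (qpP * dP)) ∈ BB dP := BB_fst dP _
  have hQ := bb_mul hpre (bb_Qd (fun i j => bb_MM bb_Wt i j))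
  have hP := fun k => bb_mul hpre (bb_nn (fun i j => bb_MM bb_Wt i j) k)
  obtain ⟨q0, q1, hq⟩ := hQ
  choose p0 p1 hp using hP
  have hq' : ∀ v r, r ^ 2 = dl v → qp (r0 v) (r1 v) * dl v * Qd (MM (Wt v r)) =
      eval v q0 + r * eval v q1 := by
    intro v r h
    have := hq ⟨(v, r), by rw [h, eval_dP]⟩
    simpa only [map_mul, eval_qpP, eval_dP] using this
  have hp' : ∀ i v r, r ^ 2 = dl v → qp (r0 v) (r1 v) * dl v * nn (MM (Wt v r)) i =
      eval v (p0 i) + r * eval v (p1 i) := by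
    intro i v r h
    have := hp i ⟨(v, r), by rw [h, eval_dP]⟩
    simpa only [map_mul, eval_qpP, eval_dP] using this
  have hA : ∀ v r, r ^ 2 = dl v → qp (r0 v) (r1 v) ≠ 0 → r ≠ 0 → Qd (MM (Wt v r)) ≠ 0 →
    Qd (MM (Wt v (-r))) ≠ 0 ∧ ∀ i, nn (MM (Wt v (-r))) i * Qd (MM (Wt v r)) = nn (MM (Wt v r)) i * Qd (MM (Wt v (-r))) := by
    intro v r h h1 h2 h3
    have h2' : -r ≠ 0 := neg_ne_zero.mpr h2
    exact lemA ((Wt_rel v r h1 h2).symm.trans (Wt_rel v (-r) h1 h2')) (Wt_YY v r h1 h2 h)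
      (Wt_YY v (-r) h1 h2' (by rw [neg_sq, h])) h3
  have hDe : ∀ v r, r ^ 2 = dl v → eval v (q0 ^ 2 - dP * q1 ^ 2) =
      (qp (r0 v) (r1 v) * dl v * Qd (MM (Wt v r))) * (qp (r0 v) (r1 v) * dl v * Qd (MM (Wt v (-r)))) := by
    intro v r h
    rw [hq' v r h, hq' v (-r) (by rw [neg_sq, h])]
    simp only [map_sub, map_mul, map_pow, eval_dP]
    linear_combination (eval v q1) ^ 2 * h
  refine ⟨fun i => p0 i * q0 - dP * (p1 i * q1), q0 ^ 2 - dP * q1 ^ 2, ?_, ?_⟩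
  · intro v r h h1 h2 h3
    have hd : dl v ≠ 0 := by rw [← h]; exact pow_ne_zero _ h2
    rw [hDe v r h]
    exact mul_ne_zero (mul_ne_zero (mul_ne_zero h1 hd) h3)
      (mul_ne_zero (mul_ne_zero h1 hd) (hA v r h h1 h2 h3).1)
  · intro v r h hD
    rw [hDe v r h] at hD
    obtain ⟨ha, hb⟩ := mul_ne_zero_iff.mp hD
    obtain ⟨hc, h3⟩ := mul_ne_zero_iff.mp ha
    obtain ⟨h1, hd⟩ := mul_ne_zero_iff.mp hc
    have h2 : r ≠ 0 := by
      rintro rfl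
      apply hd; rw [← h]; simp
    refine ⟨h1, h2, h3, fun i => ?_⟩
    rw [hDe v r h, div_eq_div_iff hD h3]
    have e1 := hq' v r h
    have e2 := hq' v (-r) (by rw [neg_sq, h])
    have e3 := hp' i v r h
    have e4 := hp' i v (-r) (by rw [neg_sq, h])
    have e5 := (hA v r h h1 h2 h3).2 i
    have e6 : eval v (p0 i * q0 - dP * (p1 i * q1)) = (qp (r0 v) (r1 v) * dl v) ^ 2 *
        (nn (MM (Wt v r)) i * Qd (MM (Wt v (-r)))) := by
      have : 2 * eval v (p0 i * q0 - dP * (p1 i * q1)) =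
        (qp (r0 v) (r1 v) * dl v * nn (MM (Wt v r)) i) * (qp (r0 v) (r1 v) * dl v * Qd (MM (Wt v (-r)))) +
        (qp (r0 v) (r1 v) * dl v * nn (MM (Wt v (-r))) i) * (qp (r0 v) (r1 v) * dl v * Qd (MM (Wt v r))) := by
        rw [e1, e2, e3, e4]
        simp only [map_sub, map_mul, eval_dP]
        linear_combination (2 * eval v (p1 i) * eval v q1) * h
      linear_combination this / 2 + (qp (r0 v) (r1 v) * dl v) ^ 2 / 2 * e5
    rw [e6]
    ring

/-- the nonvanishing locus of the section -/
lemma exists_E : ∃ E : MvPolynomial (Fin 11) ℂ, E ≠ 0 ∧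
    ∀ y r, r ^ 2 = y 1 → eval y E ≠ 0 → Qd (MM (Sec y r)) ≠ 0 := by
  have hS : ∀ s, (fun x : TT (X 1 : MvPolynomial (Fin 11) ℂ) => Sec x.1.1 x.1.2 s) ∈ BB (X 1) := by
    intro s
    refine bb_Sec (y := fun i (x : TT (X 1 : MvPolynomial (Fin 11) ℂ)) => x.1.1 i) (fun i => ?_) (BB_snd _) s
    simpa only [eval_X] using BB_fst (X 1 : MvPolynomial (Fin 11) ℂ) (X i)
  obtain ⟨e0, e1, he⟩ := bb_Qd (fun i j => bb_MM hS i j)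
  have he' : ∀ y r, r ^ 2 = y 1 → Qd (MM (Sec y r)) = eval y e0 + r * eval y e1 := by
    intro y r h
    exact he ⟨(y, r), by rw [eval_X]; exact h⟩
  refine ⟨e0 ^ 2 - X 1 * e1 ^ 2, ?_, ?_⟩
  · intro h0
    obtain ⟨h1, h2⟩ := parity 1 e0 e1 h0
    have := he' ![1, 1, 2, 0, 1, 1, 0, 0, 0, 0, 0] 1 (by simp)
    rw [h1, h2] at this
    simp [Qd, pP, sgS2, Ex, Qz, MM, Sec, r0_secw, r1_secw, mm, row0, row1, lam] at this
  · intro y r h hE h0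
    apply hE
    rw [he' y r h] at h0
    simp only [map_sub, map_mul, map_pow, eval_X]
    linear_combination (eval y e0 - r * eval y e1) * h0 + eval y e1 ^ 2 * h

def shear (w : Pt) : Pt := fun p => rho 1 0 1 1 (if p.1 = 0 then r0 w else r1 w) p.2
def swp (w : Pt) : Pt := fun p => rho 0 1 1 0 (if p.1 = 0 then r0 w else r1 w) p.2

lemma hsur_aux (w : Pt) (hy : YY w) (hq : Qd (MM w) ≠ 0) :
    ∃ v r, PRel v w ∧ r ^ 2 = dl v ∧ qp (r0 v) (r1 v) ≠ 0 ∧ r ≠ 0 := by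
  have hz : qz (r0 w) (r1 w) ≠ 0 := by
    intro h0
    apply hq
    have : Qz (MM w) = 0 := h0
    simp [Qd, Ex, this]
  have e0 : r0 (shear w) = rho 1 0 1 1 (r0 w) := by funext k; simp [r0, shear]
  have e1 : r1 (shear w) = rho 1 0 1 1 (r1 w) := by funext k; simp [r1, shear]
  have hrel : PRel w (shear w) := rel_rho 1 0 1 1 (by norm_num) _ _ e0 e1
  obtain ⟨c1, c2, c3⟩ := cov_all 1 0 1 1 (by norm_num) (r0 w) (r1 w)
  rw [← e0, ← e1, hy.1, hy.2] at c1 c2 c3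
  norm_num at c1 c2 c3
  refine ⟨shear w, qz (r0 w) (r1 w), hrel.symm, ?_, ?_, hz⟩
  · rw [dl, c1, c2, c3]; ring
  · rw [c1]; exact hz

lemma nn_one (m : Fin 9 → Fin 9 → ℂ) (h : Qd m ≠ 0) : (sgS2 (-1) m / sgS2 1 m) ^ 2 = nn m 1 / Qd m := by
  have h' := h
  simp only [Qd] at h'
  have hS : sgS2 1 m ≠ 0 := by intro h; simp [h] at h'
  rw [div_pow, div_eq_div_iff (pow_ne_zero _ hS) h]
  simp [nn, Qd]; ring

lemma swap_aux (y : Fin 11 → ℂ) (r : ℂ) (hr : r ^ 2 = y 1) (hq : Qd (MM (Sec y r)) ≠ 0) :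
    PRel (Sec y r) (Sec y (-r)) := by
  set w := Sec y r with hw
  have e0 : r0 (swp w) = rho 0 1 1 0 (r0 w) := by funext k; simp [r0, swp]
  have e1 : r1 (swp w) = rho 0 1 1 0 (r1 w) := by funext k; simp [r1, swp]
  have hrel : PRel w (swp w) := rel_rho 0 1 1 0 (by norm_num) _ _ e0 e1
  have hy : YY w := YY_secw _ _ _ _ _ _ _ _ _ _ _ _
  have hy' : YY (swp w) := by
    obtain ⟨c1, c2, c3⟩ := cov_swap (r0 w) (r1 w)
    rw [← e0, ← e1, hy.1, hy.2] at c1 c3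
    exact ⟨by rw [c1]; ring, by rw [c3]; ring⟩
  have hM : ∀ i j, MM (swp w) i j = MM w i.rev j.rev := by
    intro i j
    rw [MM, e0, e1, rho_anti, rho_anti]
    simp [MM, mm]
  obtain ⟨s1, s2⟩ := swap_all (MM w) (MM (swp w)) (fun i j => by simp [MM, mm]) hM
  have := lemD (swp w) hy' (by rw [s1]; exact hq)
  have hyy : (fun i => nn (MM (swp w)) i / Qd (MM (swp w))) = y := by
    funext i
    rw [s1, s2, lemC y r hr i]
    exact mul_div_cancel_right₀ _ hq
  have hrr : sgS2 (-1) (MM (swp w)) / sgS2 1 (MM (swp w)) = - r := by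
    have f5 : (5 : Fin 9).rev = 3 := rfl
    have f6 : (6 : Fin 9).rev = 2 := rfl
    have f4 : (4 : Fin 9).rev = 4 := rfl
    have f3 : (3 : Fin 9).rev = 5 := rfl
    have f2 : (2 : Fin 9).rev = 6 := rfl
    have g1 : sgS2 1 (MM (swp w)) = sgS2 1 (MM w) := by
      simp only [sgS2, hM, f2, f3, f4, f5, f6]; ring
    have g2 : sgS2 (-1) (MM (swp w)) = - sgS2 (-1) (MM w) := by
      simp only [sgS2, hM, f2, f3, f4, f5, f6]; ring
    have hS : sgS2 1 (MM w) ≠ 0 := by intro h; apply hq; simp [Qd, h]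
    obtain ⟨l, _, k2, k3, _⟩ := lemC0 y r
    rw [g1, g2, div_eq_iff hS, hw, k2, k3]
    ring
  rw [hyy, hrr] at this
  exact hrel.trans this

lemma actP_surj (γ : SL2 × SL2 × ℂˣ) (v : Pt) : ∃ w, actP γ w = v := by
  let L : Pt →ₗ[ℂ] Pt :=
    { toFun := actP γ
      map_add' := by
        intro x y
        funext p
        simp only [actP, Pi.add_apply, mul_add, Finset.sum_add_distrib]
      map_smul' := by
        intro c x
        funext p
        simp only [actP, Pi.smul_apply, smul_eq_mul, RingHom.id_apply, Finset.mul_sum]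
        refine Finset.sum_congr rfl fun _ _ => ?_
        ring }
  have hinj : Function.Injective L := by
    rw [injective_iff_map_eq_zero]
    intro w hw
    have h1 : actP γ w = 0 := hw
    have h2 := (rel_act γ w).symm
    rw [h1] at h2
    obtain ⟨a, b, c, d, a', b', c', d', _, _, h3⟩ := h2
    rw [rel_rows] at h3
    obtain ⟨e0, e1⟩ := h3
    have z0 : r0 (0 : Pt) = 0 := rfl
    have z1 : r1 (0 : Pt) = 0 := rfl
    have zr : ∀ k, rho a' b' c' d' 0 k = 0 := by intro k; simp [rho]
    rw [z0, z1] at e0 e1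
    funext ⟨i, k⟩
    have hi : i = 0 ∨ i = 1 := by
      revert i; decide
    rcases hi with rfl | rfl
    · have := congrFun e0 k
      simpa [zr, r0] using this
    · have := congrFun e1 k
      simpa [zr, r1] using this
  exact (LinearMap.injective_iff_surjective.mp hinj) v

theorem final_iso : Nonempty ((invFieldAB 1 8) ≃ₐ[ℂ] FractionRing (MvPolynomial (Fin 11) ℂ)) := by
  obtain ⟨N, D, hD1, hD2⟩ := exists_ND
  obtain ⟨E, hE, hE2⟩ := exists_E
  have key : ∀ v w, PRel v w → YY w → Qd (MM w) ≠ 0 → eval v D ≠ 0 →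
      ∀ i, eval v (N i) / eval v D = nn (MM w) i / Qd (MM w) := by
    intro v w hvw hy hq hv i
    obtain ⟨r, hr⟩ := sq_exists (dl v)
    obtain ⟨h1, h2, h3, h4⟩ := hD2 v r hr hv
    rw [h4 i]
    have := (lemA ((Wt_rel v r h1 h2).symm.trans hvw) (Wt_YY v r h1 h2 hr) hy h3).2 i
    rw [div_eq_div_iff h3 hq, this]
  have hsur : ∀ y, eval y E ≠ 0 → ∃ v, eval v D ≠ 0 ∧ ∀ j, eval v (N j) = y j * eval v D := by
    intro y hy
    obtain ⟨r, hr⟩ := sq_exists (y 1)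
    have hq := hE2 y r hr hy
    have hY : YY (Sec y r) := YY_secw _ _ _ _ _ _ _ _ _ _ _ _
    obtain ⟨v, ρ, h1, h2, h3, h4⟩ := hsur_aux _ hY hq
    have hv : eval v D ≠ 0 := hD1 v ρ h2 h3 h4
      (lemA (h1.symm.trans (Wt_rel v ρ h3 h4)) hY (Wt_YY v ρ h3 h4 h2) hq).1
    refine ⟨v, hv, fun j => ?_⟩
    have := key v _ h1 hY hq hv j
    rw [lemC y r hr j, mul_div_cancel_right₀ _ hq, div_eq_iff hv] at this
    exact this
  have hD : D ≠ 0 := by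
    intro h0
    have : ∃ y, eval y E ≠ 0 := by
      by_contra hcon
      push Not at hcon
      exact hE (MvPolynomial.funext fun y => by rw [hcon y, map_zero])
    obtain ⟨y, hy⟩ := this
    obtain ⟨v, hv, _⟩ := hsur y hy
    apply hv
    rw [h0, map_zero]
  refine abstract_iso (fun γ : SL2 × SL2 × ℂˣ => coordHomAB 1 8 γ.1 γ.2.1 γ.2.2) actP hactP
    ?_ ?_ ?_ N D hD ?_ (1 : Fin 11) Sec ?_ E hE ?_ hsur ?_
  · intro i v
    exact act_rel (rel_act i v).symm
  · intro i v
    exact actP_surj i v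
  · intro i j v
    obtain ⟨k, hk⟩ := act_rel ((rel_act i v).trans (rel_act j _))
    exact ⟨k, hk.symm⟩
  · intro i v h1 h2 j
    obtain ⟨r, hr⟩ := sq_exists (dl v)
    obtain ⟨k1, k2, k3, k4⟩ := hD2 v r hr h1
    have := key (actP i v) (Wt v r) ((rel_act i v).symm.trans (Wt_rel v r k1 k2))
      (Wt_YY v r k1 k2 hr) k3 h2 j
    rw [← k4 j] at this
    rwa [div_eq_div_iff h2 h1] at this
  · intro s
    refine bb_Sec (y := fun i (x : TT (X 1 : MvPolynomial (Fin 11) ℂ)) => x.1.1 i) (fun i => ?_) (BB_snd _) s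
    simpa only [eval_X] using BB_fst (X 1 : MvPolynomial (Fin 11) ℂ) (X i)
  · intro y r hr hy
    exact act_rel (swap_aux y r hr (hE2 y r hr hy))
  · intro v hv
    obtain ⟨r, hr⟩ := sq_exists (dl v)
    obtain ⟨k1, k2, k3, k4⟩ := hD2 v r hr hv
    refine ⟨sgS2 (-1) (MM (Wt v r)) / sgS2 1 (MM (Wt v r)), ?_, ?_⟩
    · rw [k4 1]
      exact nn_one _ k3
    · have : (fun j => eval v (N j) / eval v D) = fun i => nn (MM (Wt v r)) i / Qd (MM (Wt v r)) := funext k4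
      rw [this]
      exact act_rel ((lemD _ (Wt_YY v r k1 k2 hr) k3).symm.trans (Wt_rel v r k1 k2).symm)


end helpers

/-- **Rationality of `P(V_{1,8}) / (SL₂(ℂ) × SL₂(ℂ))`**: the field of invariant rational
functions is purely transcendental over `ℂ` of transcendence degree 11. -/
theorem quotient_rational_1_8 :
    Nonempty ((invFieldAB 1 8) ≃ₐ[ℂ] FractionRing (MvPolynomial (Fin 11) ℂ)) := by
  exact final_iso
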